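/- arXiv:2112.12111 — 7 statements merged into one kernel-verified Lean document; each statement's English description precedes it below -/
import Mathlib

section
/- Let a group G act on a set W, let t ∈ G, and let X⁺, X⁻, Y ⊆ W be subsets such that t⁻¹•w ∈ X⁺ for every w ∈ Y ∪ X⁺ and t•w ∈ X⁻ for every w ∈ Y ∪ X⁻. Then for every nonzero integer i and every w ∈ Y one has tⁱ•w ∈ X⁺ ∪ X⁻. -/
/-- If `g` maps `Y ∪ X` into `X`, then so do all positive powers of `g` on `Y`. -/
theorem pow_succ_smul_mem_of_smul_mem {M W : Type*} [Monoid M] [MulAction M W] {g : M}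
    {X Y : Set W} (h : ∀ w ∈ Y ∪ X, g • w ∈ X) (n : ℕ) {w : W} (hw : w ∈ Y) :
    g ^ (n + 1) • w ∈ X := by
  induction n with
  | zero => simpa using h w (Or.inl hw)
  | succ n ih =>
    rw [pow_succ', mul_smul]
    exact h _ (Or.inr ih)

/-- Ping pong for the cyclic group generated by `t`: if `t⁻¹` maps `Y ∪ X⁺` into `X⁺`
and `t` maps `Y ∪ X⁻` into `X⁻`, then every nonzero power of `t` maps `Y` into `X⁺ ∪ X⁻`. -/
theorem powers_map_Y_into_X {G W : Type*} [Group G] [MulAction G W] (t : G)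
    (Xp Xm Y : Set W)
    (hp : ∀ w ∈ Y ∪ Xp, t⁻¹ • w ∈ Xp)
    (hm : ∀ w ∈ Y ∪ Xm, t • w ∈ Xm) :
    ∀ i : ℤ, i ≠ 0 → ∀ w ∈ Y, t ^ i • w ∈ Xp ∪ Xm := by
  intro i hi w hw
  rcases i with (_ | n) | n
  · exact absurd rfl hi
  · right
    rw [Int.ofNat_eq_natCast, zpow_natCast]
    exact pow_succ_smul_mem_of_smul_mem hm n hw
  · left
    rw [zpow_negSucc, ← inv_pow]
    exact pow_succ_smul_mem_of_smul_mem hp n hw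
end

section
/- Let K be a field, n ≥ 1, and let f and g be monic polynomials of degree n over K with f(0) ≠ 0. Let A and B be the companion matrices of f and g respectively (so A is invertible). Then the matrix B·A⁻¹ − I has rank at most 1, and its rank equals 1 if and only if f ≠ g. -/
open Matrix Polynomial

/-- The companion matrix of a (monic degree `n`) polynomial `p`:
the `n × n` matrix with subdiagonal entries `1`, last column
`(-c₀, …, -c_{n-1})ᵀ`, and `0` elsewhere. -/
def companionMatrix {K : Type*} [CommRing K] (n : ℕ) (p : Polynomial K) :
    Matrix (Fin n) (Fin n) K :=
  Matrix.of fun i j =>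
    if (j : ℕ) + 1 = n then -p.coeff i
    else if (i : ℕ) = (j : ℕ) + 1 then 1 else 0

/-- A matrix over a field has rank zero exactly when it is zero. -/
theorem matrix_rank_eq_zero_iff {K m n : Type*} [Field K] [Fintype n] [Finite m]
    {M : Matrix m n K} : M.rank = 0 ↔ M = 0 := by
  classical
  rw [Matrix.rank, Submodule.finrank_eq_zero, LinearMap.range_eq_bot,
    ← Matrix.toLin'_apply', LinearEquiv.map_eq_zero_iff]

/-- The companion matrix of a polynomial with nonzero constant term is invertible. -/
theorem isUnit_det_companionMatrix {K : Type*} [Field K] {n : ℕ} {p : Polynomial K}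
    (hp : p.coeff 0 ≠ 0) : IsUnit (companionMatrix n p).det := by
  rw [isUnit_iff_ne_zero]
  intro hdet
  obtain ⟨v, hv, hvA⟩ := Matrix.exists_vecMul_eq_zero_iff.mpr hdet
  have hpos : ∀ i : Fin n, (i : ℕ) ≠ 0 → v i = 0 := by
    intro i hi
    have h := congrFun hvA ⟨i - 1, by omega⟩
    have hlast : ¬ ((i : ℕ) - 1 + 1 = n) := by omega
    have hsub : (i : ℕ) - 1 + 1 = i := by omega
    simpa [Matrix.vecMul, dotProduct, companionMatrix, hlast, hsub, ← Fin.ext_iff,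
      i.isLt.ne] using h
  refine hv (funext fun i => ?_)
  by_cases hi : (i : ℕ) = 0
  · have h := congrFun hvA ⟨n - 1, by omega⟩
    have hlast : n - 1 + 1 = n := by omega
    simp only [Matrix.vecMul, dotProduct, companionMatrix, Matrix.of_apply, hlast, if_true,
      Pi.zero_apply] at h
    rw [Finset.sum_eq_single i (fun j _ hji => by
      rw [hpos j fun hj => hji (Fin.ext (hj.trans hi.symm)), zero_mul]) (by simp), hi] at h
    simpa [hp] using h
  · exact hpos i hi

/-- Two companion matrices of the same size differ only in the last column. -/
theorem companionMatrix_sub_companionMatrix {R : Type*} [CommRing R] (n : ℕ)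
    (p q : Polynomial R) :
    companionMatrix n q - companionMatrix n p =
      Matrix.vecMulVec (fun i : Fin n => p.coeff i - q.coeff i)
        (fun j : Fin n => if (j : ℕ) + 1 = n then 1 else 0) := by
  ext i j
  simp only [companionMatrix, Matrix.sub_apply, Matrix.of_apply, Matrix.vecMulVec_apply]
  split_ifs <;> ring

/-- The companion matrix determines a monic polynomial of positive degree. -/
theorem companionMatrix_inj {R : Type*} [CommRing R] {n : ℕ} (hn : 1 ≤ n)
    {p q : Polynomial R} (hp : p.Monic) (hq : q.Monic) (hpn : p.natDegree = n)
    (hqn : q.natDegree = n) : companionMatrix n p = companionMatrix n q ↔ p = q := by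
  refine ⟨fun h => ?_, fun h => h ▸ rfl⟩
  ext k
  rcases lt_trichotomy k n with hk | rfl | hk
  · have hlast : n - 1 + 1 = n := by omega
    simpa [companionMatrix, hlast] using congrFun (congrFun h ⟨k, hk⟩) ⟨n - 1, by omega⟩
  · rw [← hpn, hp.coeff_natDegree, hpn, ← hqn, hq.coeff_natDegree]
  · rw [Polynomial.coeff_eq_zero_of_natDegree_lt (hpn.trans_lt hk),
      Polynomial.coeff_eq_zero_of_natDegree_lt (hqn.trans_lt hk)]

/-- If `f, g` are monic of degree `n ≥ 1` over a field with `f(0) ≠ 0`, and `A, B` are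
their companion matrices, then `B * A⁻¹ - 1` has rank at most one, with rank exactly
one iff `f ≠ g`. -/
theorem rank_companion_mul_inv_companion_sub_one {K : Type*} [Field K]
    (n : ℕ) (hn : 1 ≤ n) (f g : Polynomial K)
    (hf : f.Monic) (hg : g.Monic) (hfn : f.natDegree = n) (hgn : g.natDegree = n)
    (hf0 : f.eval 0 ≠ 0) :
    (companionMatrix n g * (companionMatrix n f)⁻¹ - 1).rank ≤ 1 ∧
      ((companionMatrix n g * (companionMatrix n f)⁻¹ - 1).rank = 1 ↔ f ≠ g) := by
  rw [← Polynomial.coeff_zero_eq_eval_zero] at hf0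
  have hA := isUnit_det_companionMatrix (n := n) hf0
  have hrank : (companionMatrix n g * (companionMatrix n f)⁻¹ - 1).rank =
      (companionMatrix n g - companionMatrix n f).rank := by
    rw [← Matrix.rank_mul_eq_left_of_isUnit_det (companionMatrix n f) _ hA, sub_mul, one_mul,
      Matrix.nonsing_inv_mul_cancel_right _ _ hA]
  have hle : (companionMatrix n g - companionMatrix n f).rank ≤ 1 := by
    rw [companionMatrix_sub_companionMatrix]
    exact Matrix.rank_vecMulVec_le _ _
  rw [hrank]
  refine ⟨hle, ?_⟩
  have hzero : (companionMatrix n g - companionMatrix n f).rank = 0 ↔ f = g := by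
    rw [matrix_rank_eq_zero_iff, sub_eq_zero, companionMatrix_inj hn hg hf hgn hfn, eq_comm]
  rw [ne_eq, ← hzero]
  omega
end

section
/- Let K be a field and let p be a monic self-reciprocal polynomial of degree n over K, i.e. the i-th coefficient of p equals its (n−i)-th coefficient for all 0 ≤ i ≤ n (equivalently xⁿ·p(1/x) = p(x)). Let C be the companion matrix of p and let P be the n×n permutation matrix sending the basis vector e_i to e_{n+1−i} for 1 ≤ i ≤ n. Then C is invertible, P² = I, and P·C·P = C⁻¹. -/
open Matrix Polynomial

/-- The `n × n` permutation matrix sending the basis vector `eᵢ` to `e_{n+1-i}`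
(in `1`-indexed notation), i.e. with `(i, j)` entry `1` exactly when `i + j + 1 = n`
in `0`-indexed notation. -/
def reversalPermMatrix (K : Type*) [CommRing K] (n : ℕ) : Matrix (Fin n) (Fin n) K :=
  Matrix.of fun i j => if (i : ℕ) + (j : ℕ) + 1 = n then 1 else 0

/-- The reversal matrix is the identity matrix with its rows reversed. -/
theorem reversalPermMatrix_eq_submatrix (K : Type*) [CommRing K] (n : ℕ) :
    reversalPermMatrix K n = (1 : Matrix (Fin n) (Fin n) K).submatrix Fin.revPerm id := by
  ext i j
  simp only [reversalPermMatrix, of_apply, submatrix_apply, one_apply, Fin.ext_iff,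
    Fin.revPerm_apply, Fin.val_rev, id]
  exact if_congr (by omega) rfl rfl

theorem reversalPermMatrix_mul {K : Type*} [CommRing K] {n : ℕ} (M : Matrix (Fin n) (Fin n) K) :
    reversalPermMatrix K n * M = M.submatrix Fin.revPerm id := by
  rw [reversalPermMatrix_eq_submatrix]
  exact one_submatrix_mul _ (Equiv.refl _) M

theorem mul_reversalPermMatrix {K : Type*} [CommRing K] {n : ℕ} (M : Matrix (Fin n) (Fin n) K) :
    M * reversalPermMatrix K n = M.submatrix id Fin.revPerm := by
  rw [reversalPermMatrix_eq_submatrix, mul_submatrix_one]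
  rfl

theorem reversalPermMatrix_mul_self (K : Type*) [CommRing K] (n : ℕ) :
    reversalPermMatrix K n * reversalPermMatrix K n = 1 := by
  rw [reversalPermMatrix_mul, reversalPermMatrix_eq_submatrix]
  ext i j
  simp [one_apply]

theorem companionMatrix_mul_submatrix_rev {K : Type*} [CommRing K] {n : ℕ} {p : Polynomial K}
    (hp : p.Monic) (hpn : p.natDegree = n) (hsr : ∀ i ≤ n, p.coeff i = p.coeff (n - i)) :
    companionMatrix n p * (companionMatrix n p).submatrix Fin.revPerm Fin.revPerm = 1 := by
  obtain _ | m := n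
  · exact Subsingleton.elim _ _
  have hlead : p.coeff (m + 1) = 1 := hpn ▸ hp.coeff_natDegree
  have hzero : p.coeff 0 = 1 := by simpa [hlead] using hsr 0 (Nat.zero_le _)
  ext i j
  rw [mul_apply]
  induction j using Fin.cases with
  | zero =>
    have hcol (k : Fin (m + 1)) :
        companionMatrix (m + 1) p k.rev (Fin.rev 0) = -p.coeff (k + 1) := by
      rw [hsr (k + 1) (by omega)]
      simp [companionMatrix, Fin.val_rev]
    simp only [submatrix_apply, Fin.revPerm_apply, hcol, Fin.sum_univ_castSucc]
    induction i using Fin.cases with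
    | zero => simp [companionMatrix, hlead, hzero, Fin.val_castSucc, (Fin.is_lt _).ne]
    | succ i =>
      simp [companionMatrix, hlead, (Fin.is_lt _).ne, ← Fin.ext_iff]
  | succ j =>
    have hcol (k : Fin (m + 1)) :
        companionMatrix (m + 1) p k.rev j.succ.rev = if k = j.castSucc then 1 else 0 := by
      simp only [companionMatrix, of_apply, Fin.val_rev, Fin.ext_iff, Fin.val_succ,
        Fin.val_castSucc]
      rw [if_neg (by omega)]
      exact if_congr (by omega) rfl rfl
    simp only [submatrix_apply, Fin.revPerm_apply, hcol]
    rw [Fintype.sum_eq_single j.castSucc fun k hk => by simp [hk]]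
    simp [companionMatrix, j.is_lt.ne, one_apply, Fin.ext_iff]

/-- If `p` is a monic self-reciprocal polynomial of degree `n` over a field `K`,
`C` its companion matrix and `P` the reversal permutation matrix, then `C` is
invertible, `P² = 1` and `P * C * P = C⁻¹`. -/
theorem companion_selfReciprocal {K : Type*} [Field K] (n : ℕ) (p : Polynomial K)
    (hp : p.Monic) (hpn : p.natDegree = n)
    (hsr : ∀ i ≤ n, p.coeff i = p.coeff (n - i)) :
    IsUnit (companionMatrix n p) ∧
      reversalPermMatrix K n * reversalPermMatrix K n = 1 ∧
      reversalPermMatrix K n * companionMatrix n p * reversalPermMatrix K n =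
        (companionMatrix n p)⁻¹ := by
  have hinv := companionMatrix_mul_submatrix_rev hp hpn hsr
  refine ⟨IsUnit.of_mul_eq_one _ hinv, reversalPermMatrix_mul_self K n, ?_⟩
  rw [inv_eq_right_inv hinv, reversalPermMatrix_mul, mul_reversalPermMatrix]
  rfl
end

section
/- Let K be a field and let f and g be monic self-reciprocal polynomials of degree n over K, i.e. for each of f and g the i-th coefficient equals the (n−i)-th coefficient for all 0 ≤ i ≤ n. Let A and B be the companion matrices of f and g, let P be the n×n permutation matrix sending e_i to e_{n+1−i}, and set T = B·A⁻¹ and E = B·P. Then E² = I, E·B·E⁻¹ = B⁻¹, and E·T·E⁻¹ = T⁻¹. -/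
open Matrix Polynomial

theorem mul_reversalPermMatrix_apply {K : Type*} [CommRing K] {n : ℕ}
    (M : Matrix (Fin n) (Fin n) K) (i j : Fin n) :
    (M * reversalPermMatrix K n) i j = M i j.rev := by
  rw [Matrix.mul_apply, Finset.sum_eq_single j.rev]
  · have h : (j.rev : ℕ) + j + 1 = n := by rw [Fin.val_rev]; omega
    simp only [reversalPermMatrix, Matrix.of_apply, if_pos h, mul_one]
  · intro k _ hk
    have h : ¬ ((k : ℕ) + j + 1 = n) := fun h => hk (Fin.ext (by rw [Fin.val_rev]; omega))
    simp only [reversalPermMatrix, Matrix.of_apply, if_neg h, mul_zero]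
  · simp

theorem companionMatrix_mul_reversalPermMatrix_apply {K : Type*} [CommRing K] {n : ℕ}
    (p : Polynomial K) (i j : Fin n) :
    (companionMatrix n p * reversalPermMatrix K n) i j =
      if (j : ℕ) = 0 then -p.coeff i else if (i : ℕ) + j = n then 1 else 0 := by
  rw [mul_reversalPermMatrix_apply]
  simp only [companionMatrix, Matrix.of_apply, Fin.val_rev]
  split_ifs <;> first | rfl | omega

/-- The companion matrix of a self-reciprocal polynomial, multiplied by the reversal
permutation matrix, is an involution. -/
theorem companionMatrix_mul_reversalPermMatrix_mul_self {K : Type*} [CommRing K] {n : ℕ}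
    (p : Polynomial K) (hp : p.Monic) (hn : p.natDegree = n)
    (hsr : ∀ i ≤ n, p.coeff i = p.coeff (n - i)) :
    companionMatrix n p * reversalPermMatrix K n *
      (companionMatrix n p * reversalPermMatrix K n) = 1 := by
  have h0 : p.coeff 0 = 1 := by
    rw [hsr 0 n.zero_le, Nat.sub_zero, ← hn]
    exact hp
  ext i k
  have hi := i.isLt
  have hk := k.isLt
  rw [Matrix.mul_apply, Matrix.one_apply]
  simp only [companionMatrix_mul_reversalPermMatrix_apply, Fin.ext_iff]
  by_cases hk0 : (k : ℕ) = 0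
  · simp only [hk0, if_true]
    by_cases hi0 : (i : ℕ) = 0
    · rw [Finset.sum_eq_single i]
      · simp [hi0, h0]
      · intro j _ hj
        rw [if_neg (fun h => hj (Fin.ext (by omega))), if_neg (by omega), zero_mul]
      · simp
    · have hne : (⟨0, by omega⟩ : Fin n) ≠ ⟨n - i, by omega⟩ := by
        simp only [ne_eq, Fin.mk.injEq]; omega
      rw [Fintype.sum_eq_add _ _ hne]
      · have h1 : n - (i : ℕ) ≠ 0 := by omega
        have h2 : (i : ℕ) + (n - i) = n := by omega
        simp [h0, hi0, h1, h2, ← hsr i hi.le]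
      · rintro j ⟨hj0, hj1⟩
        rw [if_neg (fun h => hj0 (Fin.ext h)),
          if_neg (fun h => hj1 (Fin.ext (by simp only; omega))), zero_mul]
  · simp only [hk0, if_false]
    rw [Finset.sum_eq_single ⟨n - k, by omega⟩]
    · have h1 : n - (k : ℕ) ≠ 0 := by omega
      have h2 : n - (k : ℕ) + k = n := by omega
      simp only [h1, h2, if_false, if_true, mul_one]
      congr 1
      apply propext
      omega
    · intro j _ hj
      rw [if_neg (c := (j : ℕ) + k = n) (fun h => hj (Fin.ext (by simp only; omega))), mul_zero]
    · simp

/-- If `f, g` are monic self-reciprocal polynomials of degree `n` over a field `K`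
with companion matrices `A, B`, and `T = B * A⁻¹`, `E = B * P` with `P` the reversal
permutation matrix, then `E² = 1`, `E * B * E⁻¹ = B⁻¹` and `E * T * E⁻¹ = T⁻¹`. -/
theorem conjugation_by_E {K : Type*} [Field K] (n : ℕ) (f g : Polynomial K)
    (hf : f.Monic) (hg : g.Monic) (hfn : f.natDegree = n) (hgn : g.natDegree = n)
    (hsrf : ∀ i ≤ n, f.coeff i = f.coeff (n - i))
    (hsrg : ∀ i ≤ n, g.coeff i = g.coeff (n - i)) :
    let A := companionMatrix n f
    let B := companionMatrix n g
    let T := B * A⁻¹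
    let E := B * reversalPermMatrix K n
    E * E = 1 ∧ E * B * E⁻¹ = B⁻¹ ∧ E * T * E⁻¹ = T⁻¹ := by
  intro A B T E
  set P := reversalPermMatrix K n
  have hP : P * P = 1 := reversalPermMatrix_mul_self K n
  have hA : A * P * (A * P) = 1 := companionMatrix_mul_reversalPermMatrix_mul_self f hf hfn hsrf
  have hB : B * P * (B * P) = 1 := companionMatrix_mul_reversalPermMatrix_mul_self g hg hgn hsrg
  have hA' : A⁻¹ = P * A * P := Matrix.inv_eq_right_inv (by simpa only [mul_assoc] using hA)
  have hB' : B⁻¹ = P * B * P := Matrix.inv_eq_right_inv (by simpa only [mul_assoc] using hB)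
  have hE : E⁻¹ = E := Matrix.inv_eq_right_inv hB
  have hBPB : B * P * B = P := by
    calc B * P * B = B * P * (B * P) * P := by simp only [mul_assoc, hP, mul_one]
      _ = P := by rw [hB, one_mul]
  refine ⟨hB, ?_, ?_⟩
  · rw [hE, hB']
    calc B * P * B * (B * P) = P * (B * P) := by rw [hBPB]
      _ = P * B * P := (mul_assoc _ _ _).symm
  · have hAA : A⁻¹⁻¹ = A := Matrix.inv_eq_left_inv
      (by rw [hA']; simpa only [mul_assoc] using hA)
    have hT : T = B * (P * A * P) := congrArg (B * ·) hA'
    rw [hE, Matrix.mul_inv_rev, hAA, hT, hB']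
    calc B * P * (B * (P * A * P)) * (B * P) = B * P * B * P * A * P * (B * P) := by
          simp only [mul_assoc]
      _ = A * (P * B * P) := by rw [hBPB, hP, one_mul]; simp only [mul_assoc]
end

section
/- Let Γ be a finite-index subgroup of the integral symplectic group Sp₆(ℤ), the group of 6×6 integer matrices M satisfying Mᵀ·J·M = J for the standard nondegenerate skew-symmetric form J. Then Γ is not isomorphic, as an abstract group, to a free product G₁ ∗ G₂ of two nontrivial abelian groups. -/
open Matrix

/-- The standard nondegenerate skew-symmetric `6 × 6` form. -/
noncomputable abbrev J6 : Matrix (Fin 3 ⊕ Fin 3) (Fin 3 ⊕ Fin 3) ℤ :=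
  Matrix.J (Fin 3) ℤ

/-- `Sp₆(ℤ)`: the group of `6 × 6` integer matrices `M` with `Mᵀ * J * M = J`. -/
def Sp6Z : Subgroup (GL (Fin 3 ⊕ Fin 3) ℤ) where
  carrier := {M | (M : Matrix (Fin 3 ⊕ Fin 3) (Fin 3 ⊕ Fin 3) ℤ)ᵀ * J6 *
    (M : Matrix (Fin 3 ⊕ Fin 3) (Fin 3 ⊕ Fin 3) ℤ) = J6}
  one_mem' := by simp
  mul_mem' := by
    intro a b ha hb
    simp only [Set.mem_setOf_eq] at *
    have key : ((a * b : GL (Fin 3 ⊕ Fin 3) ℤ) : Matrix _ _ ℤ)ᵀ * J6 *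
        ((a * b : GL (Fin 3 ⊕ Fin 3) ℤ) : Matrix _ _ ℤ) =
        (b : Matrix _ _ ℤ)ᵀ * (((a : Matrix _ _ ℤ))ᵀ * J6 * (a : Matrix _ _ ℤ)) *
          (b : Matrix _ _ ℤ) := by
      simp only [Units.val_mul, Matrix.transpose_mul, Matrix.mul_assoc]
    rw [key, ha, hb]
  inv_mem' := by
    intro a ha
    simp only [Set.mem_setOf_eq] at *
    have h1 : ((a⁻¹ : GL (Fin 3 ⊕ Fin 3) ℤ) : Matrix _ _ ℤ)ᵀ * J6 *
        ((a⁻¹ : GL (Fin 3 ⊕ Fin 3) ℤ) : Matrix _ _ ℤ) =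
        ((a⁻¹ : GL (Fin 3 ⊕ Fin 3) ℤ) : Matrix _ _ ℤ)ᵀ *
          (((a : Matrix _ _ ℤ))ᵀ * J6 * (a : Matrix _ _ ℤ)) *
          ((a⁻¹ : GL (Fin 3 ⊕ Fin 3) ℤ) : Matrix _ _ ℤ) := by rw [ha]
    have h2 : ((a : Matrix (Fin 3 ⊕ Fin 3) (Fin 3 ⊕ Fin 3) ℤ)) *
        ((a⁻¹ : GL (Fin 3 ⊕ Fin 3) ℤ) : Matrix _ _ ℤ) = 1 := a.mul_inv
    calc ((a⁻¹ : GL (Fin 3 ⊕ Fin 3) ℤ) : Matrix _ _ ℤ)ᵀ * J6 *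
        ((a⁻¹ : GL (Fin 3 ⊕ Fin 3) ℤ) : Matrix _ _ ℤ)
        = ((a : Matrix _ _ ℤ) * ((a⁻¹ : GL (Fin 3 ⊕ Fin 3) ℤ) : Matrix _ _ ℤ))ᵀ * J6 *
            ((a : Matrix _ _ ℤ) * ((a⁻¹ : GL (Fin 3 ⊕ Fin 3) ℤ) : Matrix _ _ ℤ)) := by
          rw [h1]; simp only [Matrix.transpose_mul, Matrix.mul_assoc]
      _ = J6 := by rw [h2]; simp

namespace Monoid.Coprod

variable {A B : Type*} [Group A] [Group B]

/-- The free product `A ∗ B` acts on `(A × B) × F`, where `F` is free on `A × B`: this is the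
monodromy action on the cover of the free product with fibre `A × B`, with `F`-valued cocycle
trivial along `A` and equal to a difference of generators along `B`. -/
def cocycleAction : A ∗ B →* Function.End ((A × B) × FreeGroup (A × B)) :=
  lift
    { toFun := fun a q => ((a * q.1.1, q.1.2), q.2)
      map_one' := by funext q; simp [Function.End.one_def]
      map_mul' := fun a a' => funext fun q =>
        Prod.ext (Prod.ext (mul_assoc _ _ _) rfl) rfl }
    { toFun := fun b q => ((q.1.1, b * q.1.2),
        (FreeGroup.of (q.1.1, b * q.1.2))⁻¹ * FreeGroup.of q.1 * q.2)
      map_one' := by funext q; simp [Function.End.one_def]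
      map_mul' := fun b b' => funext fun q =>
        Prod.ext (Prod.ext rfl (mul_assoc _ _ _)) <| by
          change _ = (FreeGroup.of (q.1.1, b * (b' * q.1.2)))⁻¹ * FreeGroup.of (q.1.1, b' * q.1.2) *
            ((FreeGroup.of (q.1.1, b' * q.1.2))⁻¹ * FreeGroup.of q.1 * q.2)
          simp [mul_assoc] }

theorem cocycleAction_inl (a : A) (q : (A × B) × FreeGroup (A × B)) :
    cocycleAction (inl a) q = ((a * q.1.1, q.1.2), q.2) := rfl

theorem cocycleAction_inr (b : B) (q : (A × B) × FreeGroup (A × B)) :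
    cocycleAction (inr b) q = ((q.1.1, b * q.1.2),
      (FreeGroup.of (q.1.1, b * q.1.2))⁻¹ * FreeGroup.of q.1 * q.2) := rfl

theorem cocycleAction_mul (g h : A ∗ B) (q : (A × B) × FreeGroup (A × B)) :
    cocycleAction (g * h) q = cocycleAction g (cocycleAction h q) := by
  rw [map_mul]; rfl

theorem cocycleAction_fst (g : A ∗ B) (q : (A × B) × FreeGroup (A × B)) :
    (cocycleAction g q).1 = toProd g * q.1 := by
  induction g using induction_on generalizing q with
  | inl a => simp [cocycleAction_inl, Prod.ext_iff]
  | inr b => simp [cocycleAction_inr, Prod.ext_iff]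
  | mul g h hg hh => rw [cocycleAction_mul, hg, hh, map_mul, mul_assoc]

theorem cocycleAction_mul_right (g : A ∗ B) (p : A × B) (u v : FreeGroup (A × B)) :
    cocycleAction g (p, u * v) =
      ((cocycleAction g (p, u)).1, (cocycleAction g (p, u)).2 * v) := by
  induction g using induction_on generalizing p u v with
  | inl a => rfl
  | inr b => simp [cocycleAction_inr, mul_assoc]
  | mul g h hg hh => rw [cocycleAction_mul, cocycleAction_mul, hh, hg]

/-- An equivariant map from `(A × B) × F` to the free product with its left translation action. -/
def cocycleEval (q : (A × B) × FreeGroup (A × B)) : A ∗ B :=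
  inl q.1.1 * inr q.1.2 *
    FreeGroup.lift (fun p : A × B => (inr p.2 * inl p.1)⁻¹ * (inl p.1 * inr p.2)) q.2

theorem cocycleEval_cocycleAction (g : A ∗ B) (q : (A × B) × FreeGroup (A × B)) :
    cocycleEval (cocycleAction g q) = g * cocycleEval q := by
  induction g using induction_on generalizing q with
  | inl a => simp [cocycleAction_inl, cocycleEval, mul_assoc]
  | inr b => simp [cocycleAction_inr, cocycleEval, mul_assoc]
  | mul g h hg hh => rw [cocycleAction_mul, hg, hh, mul_assoc]

/-- The restriction of the cocycle to the kernel of `A ∗ B →* A × B` is a homomorphism. -/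
def kerToProdHom : (toProd : A ∗ B →* A × B).ker →* FreeGroup (A × B) where
  toFun g := (cocycleAction g.1 (1, 1)).2
  map_one' := by simp [Function.End.one_def]
  map_mul' g h := by
    have hh : cocycleAction h.1 (1, 1) = (1, (cocycleAction h.1 (1, 1)).2) := by
      ext1
      · rw [cocycleAction_fst, h.2, one_mul]
      · rfl
    rw [Subgroup.coe_mul, cocycleAction_mul, hh]
    conv_lhs => rw [← one_mul (cocycleAction h.1 (1, 1)).2, cocycleAction_mul_right]

theorem kerToProdHom_injective : Function.Injective (kerToProdHom (A := A) (B := B)) := by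
  rw [injective_iff_map_eq_one]
  intro g hg
  have h : cocycleAction g.1 (1, 1) = (1, 1) := by
    ext1
    · rw [cocycleAction_fst, g.2, one_mul]
    · exact hg
  have := cocycleEval_cocycleAction g.1 (1, 1)
  rw [h] at this
  exact Subtype.ext (right_eq_mul.mp this)

/-- The kernel of the projection `A ∗ B →* A × B` is a free group. -/
instance isFreeGroup_ker_toProd : IsFreeGroup (toProd : A ∗ B →* A × B).ker :=
  IsFreeGroup.ofMulEquiv (MonoidHom.ofInjective kerToProdHom_injective).symm

end Monoid.Coprod

theorem FreeGroup.subsingleton_of_forall_commute {ι : Type*}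
    (h : ∀ u v : FreeGroup ι, Commute u v) : Subsingleton ι := by
  classical
  refine ⟨fun i j => by_contra fun hij => ?_⟩
  let f : FreeGroup ι →* Equiv.Perm (Fin 3) :=
    FreeGroup.lift fun k => if k = i then Equiv.swap 0 1 else Equiv.swap 1 2
  have := (h (.of i) (.of j)).map f
  simp only [f, FreeGroup.lift_apply_of, if_true, if_neg (Ne.symm hij)] at this
  exact absurd this.eq (by decide)

theorem FreeGroup.isCyclic_of_subsingleton {ι : Type*} [Subsingleton ι] :
    IsCyclic (FreeGroup ι) := by
  cases isEmpty_or_nonempty ι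
  · infer_instance
  · obtain ⟨i⟩ := ‹Nonempty ι›
    refine ⟨.of i, fun u => show u ∈ Subgroup.zpowers (FreeGroup.of i) from ?_⟩
    induction u using FreeGroup.induction_on with
    | C1 => exact one_mem _
    | of j => rw [Subsingleton.elim j i]; exact Subgroup.mem_zpowers _
    | inv_of j h => exact inv_mem h
    | mul u v hu hv => exact mul_mem hu hv

/-- Commuting elements of a free group are powers of a common element. -/
theorem IsFreeGroup.exists_zpow_of_commute {G : Type*} [Group G] [IsFreeGroup G] {x y : G}
    (h : Commute x y) : ∃ (z : G) (m n : ℤ), x = z ^ m ∧ y = z ^ n := by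
  let H := Subgroup.closure ({x, y} : Set G)
  have hcomm : ∀ u v : H, Commute u v := by
    have hpair : ∀ u ∈ ({x, y} : Set G), ∀ v ∈ ({x, y} : Set G), u * v = v * u := by
      rintro u (rfl | rfl) v (rfl | rfl)
      exacts [rfl, h.eq, h.eq.symm, rfl]
    have := Subgroup.isMulCommutative_closure hpair
    exact fun u v => mul_comm' u v
  let e := IsFreeGroup.toFreeGroup H
  have := FreeGroup.subsingleton_of_forall_commute (ι := IsFreeGroup.Generators H) fun u v => by
    simpa using (hcomm (e.symm u) (e.symm v)).map e
  have := FreeGroup.isCyclic_of_subsingleton (ι := IsFreeGroup.Generators H)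
  obtain ⟨z, hz⟩ := (isCyclic_of_surjective e.symm e.symm.surjective).exists_generator
  obtain ⟨m, hm⟩ := hz ⟨x, Subgroup.subset_closure (by simp)⟩
  obtain ⟨n, hn⟩ := hz ⟨y, Subgroup.subset_closure (by simp)⟩
  exact ⟨z, m, n, by simpa using congrArg Subtype.val hm.symm,
    by simpa using congrArg Subtype.val hn.symm⟩

/-- In a group embedding into a free product of abelian groups, commuting elements of the
commutator subgroup have proportional powers. -/
theorem exists_zpow_eq_zpow_of_mem_commutator {G A B : Type*} [Group G] [CommGroup A]
    [CommGroup B] (f : G →* Monoid.Coprod A B) (hf : Function.Injective f) {x y : G}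
    (hx : x ∈ commutator G) (hy : y ∈ commutator G) (h : Commute x y) (hx1 : x ≠ 1) :
    ∃ m n : ℤ, m ≠ 0 ∧ x ^ n = y ^ m := by
  have hker : commutator G ≤ (Monoid.Coprod.toProd.comp f).ker :=
    Abelianization.commutator_subset_ker _
  let X : (Monoid.Coprod.toProd : Monoid.Coprod A B →* A × B).ker := ⟨f x, hker hx⟩
  let Y : (Monoid.Coprod.toProd : Monoid.Coprod A B →* A × B).ker := ⟨f y, hker hy⟩
  have hXY : Commute X Y := Subtype.ext (h.map f).eq
  obtain ⟨z, m, n, hm, hn⟩ := IsFreeGroup.exists_zpow_of_commute hXY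
  refine ⟨m, n, ?_, hf ?_⟩
  · rintro rfl
    refine hx1 (hf ?_)
    simpa [X] using congrArg Subtype.val hm
  · have : X ^ n = Y ^ m := by rw [hm, hn, ← _root_.zpow_mul, ← _root_.zpow_mul, mul_comm]
    simpa [X, Y] using congrArg Subtype.val this

open scoped commutatorElement

namespace Matrix.SpecialLinearGroup

variable {ι R : Type*} [Fintype ι] [DecidableEq ι] [CommRing R]

theorem transvection_zpow {i j : ι} (hij : i ≠ j) (b : R) (n : ℤ) :
    transvection hij b ^ n = transvection hij (n * b) := by
  let f : Multiplicative R →* SpecialLinearGroup ι R :=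
    { toFun := fun c => transvection hij c.toAdd
      map_one' := transvection_coeff_zero hij
      map_mul' := fun c d => transvection_add hij _ _ }
  have := (map_zpow f (.ofAdd b) n).symm
  simpa [f] using this

theorem commutatorElement_transvection {i j k : ι} (hij : i ≠ j) (hjk : j ≠ k) (hik : i ≠ k)
    (a b : R) :
    ⁅transvection hij a, transvection hjk b⁆ = transvection hik (a * b) := by
  rw [commutatorElement_def, mul_inv_eq_iff_eq_mul, mul_inv_eq_iff_eq_mul]
  apply Subtype.ext
  simp [transvection_coe, mul_add, add_mul,
    hjk.symm, hik.symm]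
  abel

theorem commute_transvection {i j k : ι} (hij : i ≠ j) (hik : i ≠ k) (a b : R) :
    Commute (transvection hij a) (transvection hik b) := by
  apply Subtype.ext
  simp [transvection_coe, mul_add, add_mul, hij.symm, hik.symm]
  abel

theorem transvection_apply_same {i j : ι} (hij : i ≠ j) (a : R) :
    (transvection hij a : Matrix ι ι R) i j = a := by
  simp [transvection_coe, hij]

theorem transvection_apply_of_ne {i j k : ι} (hij : i ≠ j) (hik : i ≠ k) (hjk : j ≠ k) (a : R) :
    (transvection hij a : Matrix ι ι R) i k = 0 := by
  simp [transvection_coe, hik, hjk]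

end Matrix.SpecialLinearGroup

/-- The Levi embedding `A ↦ diag(A, A⁻ᵀ)` of `SL₃(ℤ)` in `Sp₆(ℤ)`. -/
def leviHom : SpecialLinearGroup (Fin 3) ℤ →* Sp6Z :=
  MonoidHom.codRestrict
    (MonoidHom.toHomUnits
      { toFun := fun A : SpecialLinearGroup (Fin 3) ℤ =>
          fromBlocks (A : Matrix (Fin 3) (Fin 3) ℤ) 0 0 (A : Matrix (Fin 3) (Fin 3) ℤ).adjugateᵀ
        map_one' := by simp
        map_mul' := fun A B => by
          simp [fromBlocks_multiply, adjugate_mul_distrib] })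
    Sp6Z fun A => by
      change (fromBlocks (A : Matrix (Fin 3) (Fin 3) ℤ) 0 0 _)ᵀ * J6 * fromBlocks _ 0 0 _ = J6
      simp [Matrix.J, fromBlocks_transpose, fromBlocks_multiply, ← transpose_mul, adjugate_mul]

theorem leviHom_injective : Function.Injective leviHom := fun A B h => by
  have h' : fromBlocks A.1 0 0 A.1.adjugateᵀ = fromBlocks B.1 0 0 B.1.adjugateᵀ :=
    congrArg (fun M : Sp6Z => (M : GL (Fin 3 ⊕ Fin 3) ℤ).1) h
  exact Subtype.ext (fromBlocks_inj.mp h').1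

open SpecialLinearGroup in
/-- A finite-index subgroup of `SL₃(ℤ)` does not embed in a free product of abelian groups. -/
theorem not_injective_of_finiteIndex_SL3 (Δ : Subgroup (SpecialLinearGroup (Fin 3) ℤ))
    [Δ.FiniteIndex] {A B : Type*} [CommGroup A] [CommGroup B] (f : Δ →* Monoid.Coprod A B) :
    ¬ Function.Injective f := by
  intro hf
  obtain ⟨k, hk0, hk⟩ : ∃ k : ℤ, k ≠ 0 ∧
      ∀ {i j : Fin 3} (hij : i ≠ j), SpecialLinearGroup.transvection hij k ∈ Δ := by
    refine ⟨Δ.index.factorial, by exact_mod_cast Nat.factorial_ne_zero _, fun hij => ?_⟩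
    have := Subgroup.pow_mem_of_index_ne_zero_of_dvd (H := Δ) Subgroup.FiniteIndex.index_ne_zero
      (SpecialLinearGroup.transvection hij (1 : ℤ)) fun m hm hle => Nat.dvd_factorial hm hle
    rwa [← zpow_natCast, transvection_zpow, mul_one, Int.cast_id] at this
  have key : ∀ {i j l : Fin 3} (_ : i ≠ j) (_ : j ≠ l) (hil : i ≠ l),
      ∃ h : transvection hil (k * k) ∈ Δ, (⟨_, h⟩ : Δ) ∈ commutator Δ := by
    intro i j l hij hjl hil
    have hc := commutatorElement_transvection hij hjl hil k k
    have hmem := Subgroup.commutator_mem_commutator (G := Δ)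
      (Subgroup.mem_top ⟨_, hk hij⟩) (Subgroup.mem_top ⟨_, hk hjl⟩)
    have h : SpecialLinearGroup.transvection hil (k * k) ∈ Δ :=
      hc ▸ (⁅(⟨_, hk hij⟩ : Δ), ⟨_, hk hjl⟩⁆ : Δ).2
    have h_eq : (⟨_, h⟩ : Δ) = ⁅(⟨_, hk hij⟩ : Δ), ⟨_, hk hjl⟩⁆ := Subtype.ext hc.symm
    exact ⟨h, h_eq ▸ hmem⟩
  have h01 : (0 : Fin 3) ≠ 1 := by decide
  have h02 : (0 : Fin 3) ≠ 2 := by decide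
  have h12 : (1 : Fin 3) ≠ 2 := by decide
  obtain ⟨hx, hx'⟩ := key h02 h12.symm h01
  obtain ⟨hy, hy'⟩ := key h01 h12 h02
  have hxy : Commute (⟨_, hx⟩ : Δ) ⟨_, hy⟩ := Subtype.ext (commute_transvection h01 h02 _ _).eq
  have hx1 : (⟨_, hx⟩ : Δ) ≠ 1 := fun h => by
    have := congrArg (fun M : Δ => M.1.1 0 1) h
    simp [transvection_apply_same, hk0] at this
  obtain ⟨m, n, hm, h⟩ := exists_zpow_eq_zpow_of_mem_commutator f hf hx' hy' hxy hx1
  have h2 := congrArg (fun M : Δ => M.1.1 0 2) h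
  simp only [Subgroup.coe_zpow, transvection_zpow, transvection_apply_same,
    transvection_apply_of_ne h01 h02 h12] at h2
  simp [hm, hk0] at h2

/-- A finite-index subgroup of `Sp₆(ℤ)` is not abstractly isomorphic to a free
product of two nontrivial abelian groups. -/
theorem finiteIndex_sp6Z_not_free_product (Γ : Subgroup Sp6Z) (hΓ : Γ.FiniteIndex)
    (G₁ G₂ : Type*) [CommGroup G₁] [CommGroup G₂] [Nontrivial G₁] [Nontrivial G₂] :
    IsEmpty (Γ ≃* Monoid.Coprod G₁ G₂) := by
  refine ⟨fun e => ?_⟩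
  have : (Γ.comap leviHom).FiniteIndex := ⟨by
    rw [Subgroup.index_comap]
    exact (Subgroup.instFiniteIndex_subgroupOf Γ leviHom.range).index_ne_zero⟩
  refine not_injective_of_finiteIndex_SL3 (Γ.comap leviHom)
    (e.toMonoidHom.comp (leviHom.subgroupComap Γ)) ?_
  exact e.injective.comp fun A B h =>
    Subtype.ext (leviHom_injective (congrArg Subtype.val h))
end

section
/- Let A be the companion matrix of f(x) = (x−1)⁶ and B the companion matrix of g(x) = (x+1)⁶, regarded as elements of GL₆(ℚ), and set T = B·A⁻¹. Then T and B generate a free group of rank 2: the group homomorphism from the free group on two generators to GL₆(ℚ) sending the first generator to T and the second generator to B is injective. (This is the hypergeometric monodromy group of case A-1, with α = (0,0,0,0,0,0) and β = (1/2,1/2,1/2,1/2,1/2,1/2); in particular this group is isomorphic to ℤ ∗ ℤ.) -/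
open Matrix Polynomial

open scoped Pointwise in
/-- The ping-pong lemma for two elements all of whose nontrivial powers play. -/
theorem FreeGroup.injective_lift_pair_of_ping_pong {G α : Type} [Group G] [MulAction G α]
    (a b : G) (X Y : Set α) (hX : X.Nonempty) (hY : Y.Nonempty) (hXY : Disjoint X Y)
    (ha : ∀ n : ℤ, n ≠ 0 → ∀ x ∈ X, a ^ n • x ∈ Y)
    (hb : ∀ n : ℤ, n ≠ 0 → ∀ y ∈ Y, b ^ n • y ∈ X) :
    Function.Injective (FreeGroup.lift ![a, b]) := by
  have hlift : FreeGroup.lift ![a, b] =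
      (Monoid.CoprodI.lift fun i => FreeGroup.lift fun _ : Unit => ![a, b] i).comp
        (@freeGroupEquivCoprodI (Fin 2)).toMonoidHom := by
    ext i
    simp
  rw [hlift, MonoidHom.coe_comp]
  refine Function.Injective.comp ?_ (MulEquiv.injective freeGroupEquivCoprodI)
  have hpow (i : Fin 2) (h : FreeGroup Unit) (hne : h ≠ 1) :
      ∃ n : ℤ, n ≠ 0 ∧ FreeGroup.lift (fun _ : Unit => ![a, b] i) h = ![a, b] i ^ n := by
    obtain ⟨n, rfl⟩ := FreeGroup.freeGroupUnitEquivInt.symm.surjective h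
    refine ⟨n, ?_, ?_⟩
    · rintro rfl
      exact hne (by simp [FreeGroup.freeGroupUnitEquivInt])
    · change FreeGroup.lift _ (FreeGroup.of () ^ n) = _
      simp
  refine Monoid.CoprodI.lift_injective_of_ping_pong _ (Or.inr ⟨0, ?_⟩) ![Y, X] ?_ ?_ ?_
  · rw [FreeGroup.freeGroupUnitEquivInt.cardinal_eq, Cardinal.mk_denumerable]
    exact Cardinal.ofNat_le_aleph0
  · intro i
    fin_cases i
    · exact hY
    · exact hX
  · intro i j hij
    fin_cases i <;> fin_cases j
    · exact absurd rfl hij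
    · exact hXY.symm
    · exact hXY
    · exact absurd rfl hij
  · intro i j hij h hne
    obtain ⟨n, hn, hlift⟩ := hpow i h hne
    rw [hlift]
    rintro _ ⟨x, hx, rfl⟩
    fin_cases i <;> fin_cases j
    · exact absurd rfl hij
    · exact ha n hn x hx
    · exact hb n hn x hx
    · exact absurd rfl hij

/-- The algebraic interior of a pointed cone. -/
def PointedCone.core {V : Type} [AddCommGroup V] [Module ℚ V] (K : PointedCone ℚ V) : Set V :=
  {v | ∀ u, ∃ ε : ℚ, 0 < ε ∧ v + ε • u ∈ K}

namespace PointedCone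

variable {V : Type} [AddCommGroup V] [Module ℚ V] {K : PointedCone ℚ V}

theorem map_mem_core (f : V ≃ₗ[ℚ] V) (hf : ∀ v ∈ K, f v ∈ K) {v : V} (hv : v ∈ K.core) :
    f v ∈ K.core := by
  intro u
  obtain ⟨ε, hε, h⟩ := hv (f.symm u)
  exact ⟨ε, hε, by simpa using hf _ h⟩

theorem pos_of_mem_core (l : V →ₗ[ℚ] ℚ) (hl : ∀ v ∈ K, 0 ≤ l v) (u : V) (hu : l u ≠ 0) {v : V}
    (hv : v ∈ K.core) : 0 < l v := by
  obtain ⟨ε, hε, h⟩ := hv (-(l u) • u)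
  have := hl _ h
  simp only [map_add, map_smul, smul_eq_mul] at this
  have : 0 < ε * (l u * l u) := mul_pos hε (mul_self_pos.mpr hu)
  linarith

theorem core_nonempty_of_spanning {ι : Type} [Fintype ι] (g : ι → V) (hg : ∀ i, g i ∈ K)
    (hspan : ∀ u, ∃ a : ι → ℚ, ∑ i, a i • g i = u) : K.core.Nonempty := by
  refine ⟨∑ i, g i, fun u => ?_⟩
  obtain ⟨a, rfl⟩ := hspan u
  have hpos : 0 < 1 + ∑ i, |a i| := by positivity
  refine ⟨(1 + ∑ i, |a i|)⁻¹, inv_pos.mpr hpos, ?_⟩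
  rw [Finset.smul_sum, ← Finset.sum_add_distrib]
  refine Submodule.sum_mem _ fun i _ => ?_
  have hai : |a i| ≤ ∑ i, |a i| :=
    Finset.single_le_sum (f := fun i => |a i|) (fun i _ => abs_nonneg (a i)) (Finset.mem_univ i)
  have hnonneg : 0 ≤ 1 + (1 + ∑ i, |a i|)⁻¹ * a i := by
    have : 0 ≤ (1 + ∑ i, |a i|)⁻¹ * ((1 + ∑ i, |a i|) + a i) :=
      mul_nonneg (inv_pos.mpr hpos).le (by linarith [neg_abs_le (a i)])
    rwa [mul_add, inv_mul_cancel₀ hpos.ne'] at this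
  convert PointedCone.smul_mem K hnonneg (hg i) using 1
  module

end PointedCone

/-- Ping-pong for a transvection `t` and an automorphism `b`, played on a cone `K`. -/
theorem injective_lift_pair_of_invariant_cones {V : Type} [AddCommGroup V] [Module ℚ V]
    (t b e : V ≃ₗ[ℚ] V) (p : V) (φ h : V →ₗ[ℚ] ℚ) (K Z W : PointedCone ℚ V)
    (ht : ∀ v, t v = v + φ v • p) (hφp : φ p = 0) (hhp : h p = 2)
    (hee : e * e = 1) (hte : e * t * e = t⁻¹) (hbe : e * b * e = b⁻¹)
    (hcore : K.core.Nonempty)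
    (hφh : ∀ v ∈ K, 0 ≤ (φ - h) v) (hφh' : ∀ v ∈ K, 0 ≤ (φ + h) v)
    (heK : ∀ v ∈ K, e v ∈ K)
    (hKZ : ∀ v ∈ K, -b (t v) ∈ Z) (hpZ : -b p ∈ Z) (hZZ : ∀ v ∈ Z, -b v ∈ Z) (hZK : Z ≤ K)
    (hKW : ∀ v ∈ K, b⁻¹ (t v) ∈ W) (hpW : b⁻¹ p ∈ W) (hWW : ∀ v ∈ W, -b⁻¹ v ∈ W)
    (hWK : W ≤ K) :
    Function.Injective (FreeGroup.lift ![t, b]) := by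
  have hφ : ∀ v ∈ K, 0 ≤ φ v := fun v hv => by
    have h1 := hφh v hv
    have h2 := hφh' v hv
    rw [LinearMap.sub_apply] at h1
    rw [LinearMap.add_apply] at h2
    linarith
  have htpow (n : ℕ) (v : V) : (t ^ n) v = v + ((n : ℚ) * φ v) • p := by
    induction n with
    | zero => simp
    | succ n ih =>
      rw [pow_succ', LinearEquiv.mul_apply, ih, ht, map_add, map_smul, hφp]
      push_cast
      module
  have htn (n : ℕ) (v : V) : (t ^ (n + 1)) v = t v + ((n : ℚ) * φ v) • p := by
    rw [htpow, ht]; push_cast; module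
  have hn (n : ℕ) {v : V} (hv : v ∈ K) : 0 ≤ (n : ℚ) * φ v :=
    mul_nonneg n.cast_nonneg (hφ v hv)
  have hZ (m n : ℕ) {v : V} (hv : v ∈ K) :
      ((-1 : ℚ) ^ (m + 1)) • (b ^ (m + 1)) ((t ^ (n + 1)) v) ∈ Z := by
    induction m with
    | zero =>
      have := Z.add_mem (hKZ v hv) (PointedCone.smul_mem Z (hn n hv) hpZ)
      convert this using 1
      rw [htn]
      simp
    | succ m ih =>
      convert hZZ _ ih using 1
      rw [pow_succ' b, LinearEquiv.mul_apply, map_smul, pow_succ (-1 : ℚ)]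
      module
  have hW (m n : ℕ) {v : V} (hv : v ∈ K) :
      ((-1 : ℚ) ^ m) • (b⁻¹ ^ (m + 1)) ((t ^ (n + 1)) v) ∈ W := by
    induction m with
    | zero =>
      have := W.add_mem (hKW v hv) (PointedCone.smul_mem W (hn n hv) hpW)
      convert this using 1
      rw [htn]
      simp
    | succ m ih =>
      convert hWW _ ih using 1
      rw [pow_succ' b⁻¹, LinearEquiv.mul_apply, map_smul, pow_succ (-1 : ℚ)]
      module
  let X : Set V := {v | v ∈ K.core ∨ -v ∈ K.core}
  have hXpos (g : V ≃ₗ[ℚ] V) (hg : ∀ v ∈ K, g v ∈ K) {x : V} (hx : x ∈ X) : g x ∈ X := by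
    rcases hx with hx | hx
    · exact Or.inl (PointedCone.map_mem_core g hg hx)
    · exact Or.inr (by simpa using PointedCone.map_mem_core g hg hx)
  have hXneg (g : V ≃ₗ[ℚ] V) (s : ℚ) (hs : s = 1 ∨ s = -1) (hg : ∀ v ∈ K, s • g v ∈ K) {x : V}
      (hx : x ∈ X) : g x ∈ X := by
    rcases hs with rfl | rfl
    · exact hXpos g (by simpa using hg) hx
    · have := hXpos (g.trans (LinearEquiv.neg ℚ)) (by simpa using hg) hx
      rcases this with h | h
      · exact Or.inr (by simpa using h)
      · exact Or.inl (by simpa using h)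
  have hXtb (k : ℤ) (hk : k ≠ 0) (n : ℕ) {x : V} (hx : x ∈ X) :
      (b ^ k) ((t ^ (n + 1)) x) ∈ X := by
    rw [← LinearEquiv.mul_apply]
    rcases lt_or_gt_of_ne hk with hk | hk
    · obtain ⟨m, rfl⟩ : ∃ m : ℕ, k = -((m + 1 : ℕ) : ℤ) := ⟨(-k - 1).toNat, by omega⟩
      rw [_root_.zpow_neg, zpow_natCast, ← inv_pow]
      exact hXneg _ _ (neg_one_pow_eq_or ℚ m) (fun v hv => hWK (hW m n hv)) hx
    · obtain ⟨m, rfl⟩ : ∃ m : ℕ, k = ((m + 1 : ℕ) : ℤ) := ⟨(k - 1).toNat, by omega⟩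
      rw [zpow_natCast]
      exact hXneg _ _ (neg_one_pow_eq_or ℚ (m + 1)) (fun v hv => hZK (hZ m n hv)) hx
  have heinv : e⁻¹ = e := inv_eq_of_mul_eq_one_left hee
  have hconj {g : V ≃ₗ[ℚ] V} (hg : e * g * e = g⁻¹) (n : ℤ) : e * g ^ n * e = g ^ (-n) := by
    have := conj_zpow (a := e) (b := g) (i := n)
    rw [heinv, hg] at this
    rw [← this, _root_.inv_zpow, _root_.zpow_neg]
  have hX (k n : ℤ) (hk : k ≠ 0) (hn : n ≠ 0) {x : V} (hx : x ∈ X) :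
      (b ^ k) ((t ^ n) x) ∈ X := by
    rcases lt_or_gt_of_ne hn with hn | hn
    · obtain ⟨m, rfl⟩ : ∃ m : ℕ, n = -((m + 1 : ℕ) : ℤ) := ⟨(-n - 1).toNat, by omega⟩
      have h1 := hXpos e heK (hXtb (-k) (neg_ne_zero.mpr hk) m (hXpos e heK hx))
      have h2 : b ^ k * t ^ (-((m + 1 : ℕ) : ℤ)) = e * (b ^ (-k) * (t ^ (m + 1) * e)) := by
        rw [← hconj hte, ← neg_neg k, ← hconj hbe, neg_neg, zpow_natCast]
        simp only [mul_assoc]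
        rw [← mul_assoc e e, hee, one_mul]
      rw [← LinearEquiv.mul_apply, h2]
      exact h1
    · obtain ⟨m, rfl⟩ : ∃ m : ℕ, n = ((m + 1 : ℕ) : ℤ) := ⟨(n - 1).toNat, by omega⟩
      rw [zpow_natCast]
      exact hXtb k hk m hx
  have htz (n : ℤ) (v : V) : (t ^ n) v = v + ((n : ℚ) * φ v) • p := by
    obtain ⟨m, rfl | rfl⟩ := n.eq_nat_or_neg
    · simpa using htpow m v
    · rw [_root_.zpow_neg, zpow_natCast]
      apply (t ^ m).injective
      rw [← LinearEquiv.mul_apply, mul_inv_cancel, htpow, map_add, map_smul, hφp, LinearEquiv.coe_one]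
      push_cast
      simp only [id_eq]
      module
  have hstrict {v : V} (hv : v ∈ K.core) : h v < φ v ∧ -φ v < h v := by
    have h1 := PointedCone.pos_of_mem_core (φ - h) hφh p (by simp [hφp, hhp]) hv
    have h2 := PointedCone.pos_of_mem_core (φ + h) hφh' p (by simp [hφp, hhp]) hv
    rw [LinearMap.sub_apply] at h1
    rw [LinearMap.add_apply] at h2
    constructor <;> linarith
  have hXabs {x : V} (hx : x ∈ X) : |h x| < |φ x| := by
    rcases hx with hx | hx
    · have := hstrict hx
      rw [abs_of_pos (by linarith : 0 < φ x)]
      exact abs_lt.mpr ⟨this.2, this.1⟩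
    · have := hstrict hx
      simp only [map_neg] at this
      rw [abs_of_neg (by linarith : φ x < 0)]
      exact abs_lt.mpr ⟨by linarith, by linarith⟩
  have hXne : X.Nonempty := hcore.imp fun _ => Or.inl
  refine FreeGroup.injective_lift_pair_of_ping_pong t b X
    {y | ∃ n : ℤ, n ≠ 0 ∧ ∃ x ∈ X, (t ^ n) x = y} hXne ?_ ?_ ?_ ?_
  · obtain ⟨x, hx⟩ := hXne
    exact ⟨_, 1, one_ne_zero, x, hx, rfl⟩
  · rw [Set.disjoint_left]
    rintro _ hy ⟨n, hn, x, hx, rfl⟩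
    have h1 := hXabs hx
    have h2 := hXabs hy
    rw [htz] at h2
    simp only [map_add, map_smul, hφp, hhp, smul_eq_mul, mul_zero, add_zero] at h2
    have h3 : (1 : ℚ) ≤ |(n : ℚ)| := by exact_mod_cast Int.one_le_abs hn
    have h4 : |(n : ℚ) * φ x * 2| = |(n : ℚ)| * |φ x| * 2 := by
      rw [abs_mul, abs_mul, abs_two]
    have h5 := abs_sub_abs_le_abs_sub ((n : ℚ) * φ x * 2) (-h x)
    rw [abs_neg, sub_neg_eq_add, add_comm _ (h x)] at h5
    nlinarith [abs_nonneg (φ x)]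
  · intro n hn x hx
    exact ⟨n, hn, x, hx, rfl⟩
  · rintro k hk _ ⟨n, hn, x, hx, rfl⟩
    exact hX k n hk hn hx

/-- The rational vector with the given integer coordinates. -/
def ratVec (g : Fin 6 → ℤ) : Fin 6 → ℚ := fun i => (g i : ℚ)

/-- The rational matrix with the given integer entries. -/
def ratMat (M : Matrix (Fin 6) (Fin 6) ℤ) : Matrix (Fin 6) (Fin 6) ℚ := M.map (Int.castRingHom ℚ)

/-- The pointed cone generated by a list of integer vectors. -/
def listCone (L : List (Fin 6 → ℤ)) : PointedCone ℚ (Fin 6 → ℚ) :=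
  PointedCone.hull ℚ {v | ∃ g ∈ L, v = ratVec g}

theorem ratVec_mem_listCone {L : List (Fin 6 → ℤ)} {g : Fin 6 → ℤ} (hg : g ∈ L) :
    ratVec g ∈ listCone L :=
  PointedCone.subset_hull ⟨g, hg, rfl⟩

theorem ratMat_mulVec_ratVec (M : Matrix (Fin 6) (Fin 6) ℤ) (g : Fin 6 → ℤ) :
    ratMat M *ᵥ ratVec g = ratVec (M *ᵥ g) := by
  ext i
  simp [ratMat, ratVec, mulVec, dotProduct]

theorem listCone_le {L : List (Fin 6 → ℤ)} {C : PointedCone ℚ (Fin 6 → ℚ)}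
    (h : ∀ g ∈ L, ratVec g ∈ C) : listCone L ≤ C := by
  refine Submodule.span_le.mpr ?_
  rintro _ ⟨g, hg, rfl⟩
  exact h g hg

theorem nonneg_of_mem_listCone {L : List (Fin 6 → ℤ)} (l : (Fin 6 → ℚ) →ₗ[ℚ] ℚ)
    (h : ∀ g ∈ L, 0 ≤ l (ratVec g)) : ∀ v ∈ listCone L, 0 ≤ l v := by
  have : listCone L ≤ (PointedCone.positive ℚ ℚ).comap l := listCone_le fun g hg => by
    simpa using h g hg
  intro v hv
  simpa using this hv

/-- `cs` writes a positive multiple of `M *ᵥ g`, for each `g` in `L`, as a combination with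
natural coefficients of the vectors in `L'`, which are referred to by their indices. -/
def Certifies (M : Matrix (Fin 6) (Fin 6) ℤ) (L L' : List (Fin 6 → ℤ))
    (cs : List (ℕ × List (ℕ × ℕ))) : Prop :=
  List.Forall₂ (fun g c => 0 < c.1 ∧ ∀ i : Fin 6, (c.1 : ℤ) * (M *ᵥ g) i =
    (c.2.map fun kc => (kc.2 : ℤ) * L'.getD kc.1 0 i).sum) L cs

instance (M : Matrix (Fin 6) (Fin 6) ℤ) (L L' : List (Fin 6 → ℤ))
    (cs : List (ℕ × List (ℕ × ℕ))) : Decidable (Certifies M L L' cs) :=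
  inferInstanceAs (Decidable (List.Forall₂ _ _ _))

theorem Certifies.mulVec_mem {M : Matrix (Fin 6) (Fin 6) ℤ} {L L' : List (Fin 6 → ℤ)}
    {cs : List (ℕ × List (ℕ × ℕ))} (h : Certifies M L L' cs) :
    ∀ v ∈ listCone L, ratMat M *ᵥ v ∈ listCone L' := by
  have hgetD (k : ℕ) : ratVec (L'.getD k 0) ∈ listCone L' := by
    rcases lt_or_ge k L'.length with hk | hk
    · rw [List.getD_eq_getElem _ _ hk]
      exact ratVec_mem_listCone (List.getElem_mem hk)
    · rw [List.getD_eq_default _ _ hk]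
      convert (listCone L').zero_mem
      ext i
      simp [ratVec]
  have hsum (c : List (ℕ × ℕ)) :
      ratVec (fun i => (c.map fun kc => (kc.2 : ℤ) * L'.getD kc.1 0 i).sum) ∈ listCone L' := by
    induction c with
    | nil =>
      convert (listCone L').zero_mem
      ext i
      simp [ratVec]
    | cons kc c ih =>
      convert (listCone L').add_mem
        (PointedCone.smul_mem _ (Nat.cast_nonneg (α := ℚ) kc.2) (hgetD kc.1)) ih using 1
      ext i
      simp [ratVec]
  have hle : listCone L ≤ (listCone L').comap (ratMat M).mulVecLin := by
    refine listCone_le fun g hg => ?_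
    obtain ⟨c, hc, hsc⟩ : ∃ c : ℕ × List (ℕ × ℕ), 0 < c.1 ∧ ∀ i : Fin 6, (c.1 : ℤ) * (M *ᵥ g) i =
        (c.2.map fun kc => (kc.2 : ℤ) * L'.getD kc.1 0 i).sum := by
      induction h with
      | nil => simp at hg
      | cons hc _ ih =>
        rcases List.mem_cons.mp hg with rfl | hg
        · exact ⟨_, hc⟩
        · exact ih hg
    have hc' : (0 : ℚ) < c.1 := Nat.cast_pos.mpr hc
    rw [PointedCone.mem_comap, mulVecLin_apply, ratMat_mulVec_ratVec]
    convert PointedCone.smul_mem _ (inv_pos.mpr hc').le (hsum c.2) using 1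
    simp only [← hsc]
    ext i
    simp [ratVec, hc'.ne']
  exact fun v hv => hle hv

namespace Hypergeometric

/-- The companion matrix of `(x + 1) ^ 6`. -/
def matB : Matrix (Fin 6) (Fin 6) ℤ :=
  !![0, 0, 0, 0, 0, -1;
     1, 0, 0, 0, 0, -6;
     0, 1, 0, 0, 0, -15;
     0, 0, 1, 0, 0, -20;
     0, 0, 0, 1, 0, -15;
     0, 0, 0, 0, 1, -6]

/-- The inverse of `matB`. -/
def matBInv : Matrix (Fin 6) (Fin 6) ℤ :=
  !![-6, 1, 0, 0, 0, 0;
     -15, 0, 1, 0, 0, 0;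
     -20, 0, 0, 1, 0, 0;
     -15, 0, 0, 0, 1, 0;
     -6, 0, 0, 0, 0, 1;
     -1, 0, 0, 0, 0, 0]

/-- The transvection `T = B * A⁻¹`. -/
def matT : Matrix (Fin 6) (Fin 6) ℤ :=
  !![1, 0, 0, 0, 0, 0;
     12, 1, 0, 0, 0, 0;
     0, 0, 1, 0, 0, 0;
     40, 0, 0, 1, 0, 0;
     0, 0, 0, 0, 1, 0;
     12, 0, 0, 0, 0, 1]

/-- The inverse of `matT`. -/
def matTInv : Matrix (Fin 6) (Fin 6) ℤ :=
  !![1, 0, 0, 0, 0, 0;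
     -12, 1, 0, 0, 0, 0;
     0, 0, 1, 0, 0, 0;
     -40, 0, 0, 1, 0, 0;
     0, 0, 0, 0, 1, 0;
     -12, 0, 0, 0, 0, 1]

/-- An involution that conjugates `matT` and `matB` to their inverses. -/
def matE : Matrix (Fin 6) (Fin 6) ℤ :=
  !![1, 0, 0, 0, 0, 0;
     6, 0, 0, 0, 0, -1;
     15, 0, 0, 0, -1, 0;
     20, 0, 0, -1, 0, 0;
     15, 0, -1, 0, 0, 0;
     6, -1, 0, 0, 0, 0]

/-- The product `-(B * T)`. -/
def matNegBT : Matrix (Fin 6) (Fin 6) ℤ :=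
  !![12, 0, 0, 0, 0, 1;
     71, 0, 0, 0, 0, 6;
     168, -1, 0, 0, 0, 15;
     240, 0, -1, 0, 0, 20;
     140, 0, 0, -1, 0, 15;
     72, 0, 0, 0, -1, 6]

/-- The product `B⁻¹ * T`. -/
def matBInvT : Matrix (Fin 6) (Fin 6) ℤ :=
  !![6, 1, 0, 0, 0, 0;
     -15, 0, 1, 0, 0, 0;
     20, 0, 0, 1, 0, 0;
     -15, 0, 0, 0, 1, 0;
     6, 0, 0, 0, 0, 1;
     -1, 0, 0, 0, 0, 0]

/-- The direction of the transvection `matT`. -/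
def dirT : Fin 6 → ℤ := ![0, 12, 0, 40, 0, 12]

/-- Generators of the cone on which ping-pong is played. -/
def genK : List (Fin 6 → ℤ) := [
  ![1, 3, 2, -2, -3, -1], ![1, 3, 4, 4, 3, 1], ![5, 3, -2, 2, -3, -5], ![1, -4, 6, -4, 1, 0],
  ![2, -5, 6, -5, 2, 0], ![1, -5, 10, -10, 5, -1], ![10, 11, 4, 10, 2, -5],
  ![1, 5, 12, 16, 11, 3], ![9, -13, 18, -18, 5, -1], ![6, -16, 19, -15, 7, -1],
  ![1, 7, 18, 22, 13, 3], ![1, 6, 14, 24, 9, 10], ![1, 7, 10, 30, 5, 11],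
  ![9, -31, 42, -30, 13, -3], ![2, 12, 28, 45, 24, 17], ![23, -25, 50, 50, -25, 23],
  ![5, 35, 78, 98, 77, 27], ![37, -93, 110, -94, 45, -5], ![6, 37, 83, 135, 71, 52],
  ![111, 151, 82, 114, 31, -41], ![89, -75, 130, 170, -75, 49], ![10, 65, 148, 190, 146, 49],
  ![9, 55, 130, 198, 117, 67], ![9, 57, 122, 210, 93, 85], ![103, -135, 220, -220, 45, -13],
  ![71, -245, 342, -266, 131, -33], ![23, 115, 370, 410, 295, 163],
  ![251, -135, 300, 440, -135, 111], ![203, -297, 470, -410, 63, -29],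
  ![341, -77, 366, 530, -131, 123], ![125, -433, 610, -482, 241, -61],
  ![256, -649, 804, -694, 292, -9], ![37, 227, 510, 834, 445, 315],
  ![293, -745, 926, -806, 349, -17], ![684, -110, 725, 1035, -245, 239],
  ![869, 1201, 662, 878, 229, -319], ![843, 175, 990, 1230, -185, 243],
  ![89, 485, 1410, 1610, 1205, 609], ![71, 459, 934, 1686, 723, 671],
  ![986, -495, 1165, 1715, -495, 436], ![971, -1240, 2020, -1790, 205, -166],
  ![111, 707, 1634, 2106, 1583, 515], ![103, 631, 1500, 2280, 1325, 753],
  ![125, 811, 1634, 2982, 1265, 1183], ![203, 1247, 2982, 4470, 2575, 1515],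
  ![251, 1395, 3900, 4580, 3465, 1641], ![256, 1545, 3548, 5814, 3036, 2185],
  ![341, 1923, 5246, 6290, 4749, 2123], ![293, 1775, 4046, 6666, 3469, 2503],
  ![1633, -5633, 7850, -6082, 2981, -749], ![6667, 9209, 5074, 6742, 1763, -2447],
  ![6907, -3445, 8170, 12010, -3445, 3067], ![684, 3865, 10505, 12645, 9535, 4214],
  ![843, 4815, 12830, 15630, 11655, 4883], ![10727, -1585, 11600, 16100, -4015, 3797],
  ![869, 5533, 12806, 16502, 12373, 4013], ![986, 5480, 15285, 18005, 13625, 6411],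
  ![6727, -17065, 21126, -18370, 7987, -405], ![971, 5992, 14360, 21210, 12545, 7066],
  ![15697, -20955, 33790, -29530, 3585, -2587], ![1633, 10547, 21514, 38742, 16645, 15431],
  ![6907, 38375, 107050, 126130, 95435, 44887], ![6667, 42449, 98242, 126598, 94931, 30793],
  ![6727, 40767, 92918, 152910, 79779, 57427], ![90761, -45695, 107270, 157910, -45695, 40121],
  ![10727, 60565, 164920, 198440, 149305, 65947],
  ![15697, 96769, 231870, 343470, 201665, 115137],
  ![246701, -36405, 266380, 370280, -92025, 87181],
  ![90761, 504445, 1407110, 1657310, 1254145, 590261],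
  ![246701, 1393025, 3792540, 4563740, 3434135, 1516611]]

/-- Generators of a subcone invariant under `-B`. -/
def genZ : List (Fin 6 → ℤ) := [
  ![1, 5, 10, 10, 5, 1], ![1, 6, 14, 16, 9, 2], ![2, 12, 28, 35, 24, 7],
  ![3, 18, 42, 60, 35, 18], ![11, 65, 158, 210, 135, 61], ![11, 65, 150, 218, 127, 69],
  ![12, 71, 172, 234, 144, 71], ![13, 77, 180, 256, 151, 75], ![22, 131, 312, 426, 266, 123],
  ![24, 142, 341, 474, 285, 142], ![32, 187, 440, 554, 376, 107], ![37, 205, 490, 610, 385, 97],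
  ![42, 245, 621, 753, 533, 198], ![65, 367, 874, 1070, 661, 163],
  ![55, 325, 762, 1102, 623, 333], ![71, 420, 1009, 1401, 840, 419],
  ![105, 621, 1498, 2058, 1245, 617], ![107, 633, 1510, 2122, 1263, 637],
  ![115, 680, 1594, 2296, 1315, 688], ![124, 738, 1751, 2397, 1485, 673],
  ![151, 897, 2078, 2602, 1803, 533], ![171, 995, 2550, 3150, 2255, 831],
  ![193, 1149, 2730, 3738, 2325, 1065], ![277, 1621, 3798, 4774, 3253, 933],
  ![299, 1771, 4234, 5930, 3515, 1819], ![371, 2078, 4958, 6116, 3815, 950],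
  ![369, 2165, 5330, 6570, 4685, 1649], ![413, 2433, 5692, 7160, 4911, 1423],
  ![439, 2597, 6234, 8670, 5199, 2589], ![801, 4695, 11600, 14220, 10095, 3581],
  ![1117, 6613, 15762, 22210, 13025, 6777], ![1223, 7235, 17244, 24240, 14445, 7293],
  ![1291, 7635, 17882, 25738, 14811, 7715], ![1523, 9067, 21534, 29526, 18319, 8415],
  ![3073, 18123, 42302, 53170, 36561, 10643], ![3123, 18487, 43968, 62160, 36365, 18873],
  ![4653, 27235, 67950, 83250, 59365, 21483], ![4215, 24949, 59210, 83934, 49055, 25421],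
  ![8652, 50615, 126600, 154650, 110060, 40047], ![8447, 49998, 118607, 168215, 98310, 50927],
  ![10109, 59785, 140006, 201518, 115997, 60425], ![12268, 72622, 172683, 244195, 142865, 74103],
  ![35027, 208529, 495262, 679026, 421343, 193517],
  ![77557, 458675, 1074142, 1546066, 889933, 463579],
  ![85951, 508799, 1209826, 1710850, 1000975, 519151],
  ![132521, 784399, 1860676, 2638820, 1542635, 799141],
  ![1129253, 6684757, 15895358, 22477790, 13150445, 6821213],
  ![3047593, 18038857, 42789888, 60685480, 35475575, 18377583]]

/-- Generators of a subcone invariant under `-B⁻¹`. -/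
def genW : List (Fin 6 → ℤ) := [
  ![1, 3, 2, -2, -3, -1], ![1, 3, 4, 4, 3, 1], ![5, 3, -2, 2, -3, -5], ![1, -5, 10, -10, 5, -1],
  ![1, 5, 10, 10, 5, 1], ![10, 11, 4, 10, 2, -5], ![2, -9, 16, -14, 6, -1],
  ![9, -13, 18, -18, 5, -1], ![7, -24, 35, -28, 12, -2], ![23, -25, 50, 50, -25, 23],
  ![33, -77, 102, -78, 25, -5], ![20, -71, 105, -83, 35, -6], ![23, -93, 150, -122, 51, -9],
  ![111, 151, 82, 114, 31, -41], ![41, -117, 162, -130, 53, -9], ![89, -75, 130, 170, -75, 49],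
  ![251, -135, 300, 440, -135, 111], ![341, -77, 366, 530, -131, 123],
  ![129, -445, 646, -510, 217, -37], ![684, -110, 725, 1035, -245, 239],
  ![181, -723, 1154, -934, 393, -71], ![869, 1201, 662, 878, 229, -319],
  ![843, 175, 990, 1230, -185, 243], ![986, -495, 1165, 1715, -495, 436],
  ![483, -1325, 1840, -1500, 605, -103], ![317, -1265, 2018, -1634, 689, -125],
  ![921, -2575, 3650, -2982, 1189, -203], ![887, -3036, 4426, -3548, 1527, -256],
  ![1013, -3469, 5054, -4046, 1741, -293], ![6667, 9209, 5074, 6742, 1763, -2447],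
  ![6907, -3445, 8170, 12010, -3445, 3067], ![10727, -1585, 11600, 16100, -4015, 3797],
  ![4586, -12545, 17630, -14360, 5660, -971], ![4165, -16645, 26578, -21514, 9049, -1633],
  ![23297, -79779, 116170, -92918, 39957, -6727],
  ![90761, -45695, 107270, 157910, -45695, 40121],
  ![73227, -201665, 284410, -231870, 91595, -15697],
  ![246701, -36405, 266380, 370280, -92025, 87181]]

/-- Certificate that `-(B * T)` maps the cone `K` into `Z`. -/
def certNegBT : List (ℕ × List (ℕ × ℕ)) := [
  (1, [(5, 1)]), (1, [(7, 1)]), (1, [(14, 1)]), (1, [(6, 1)]), (1, [(9, 1)]), (1, [(4, 1)]),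
  (1, [(18, 1)]), (1, [(1, 2), (7, 1)]), (1, [(17, 1)]), (1, [(15, 1)]),
  (1, [(0, 1), (1, 2), (3, 4)]), (1, [(8, 1)]), (1, [(3, 4), (4, 1)]), (1, [(16, 1)]),
  (55, [(2, 60), (3, 29), (9, 13), (19, 14)]), (1, [(24, 1)]),
  (24, [(1, 34), (3, 480), (10, 16), (11, 1), (13, 1)]), (1, [(28, 1)]), (1, [(19, 1)]),
  (1, [(32, 1)]), (1, [(30, 1)]), (8, [(1, 34), (3, 320), (10, 8), (11, 1), (13, 1)]),
  (3, [(1, 4), (2, 64), (3, 24), (17, 3)]), (1, [(22, 1)]), (1, [(31, 1)]),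
  (307, [(1, 1314), (6, 1952), (12, 108), (13, 9), (15, 1284), (16, 1242)]),
  (3, [(2, 108), (3, 5), (4, 10), (7, 18), (8, 25), (9, 8)]), (1, [(35, 1)]),
  (1935, [(0, 708), (5, 17235), (12, 1220), (17, 32715), (21, 82), (24, 3015)]), (1, [(37, 1)]),
  (614, [(1, 5694), (6, 10096), (12, 468), (13, 39), (15, 5564), (16, 3233)]),
  (1160, [(3, 1458), (4, 1440), (9, 139336), (17, 1215), (19, 288), (21, 135)]),
  (165, [(2, 1856), (3, 15140), (7, 286), (10, 230), (19, 432), (21, 67)]),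
  (7, [(1, 34), (3, 90), (9, 920), (14, 1), (17, 16), (21, 2)]), (1, [(39, 1)]), (1, [(40, 1)]),
  (1, [(0, 1), (3, 184), (5, 45), (14, 60), (17, 45), (24, 4)]),
  (209, [(2, 17644), (3, 18499), (8, 6381), (10, 1130), (17, 666), (19, 96)]), (1, [(33, 1)]),
  (1, [(41, 1)]),
  (1512, [(5, 73509), (11, 821), (14, 9116), (17, 120903), (21, 521), (24, 10036)]),
  (9, [(1, 1028), (3, 2836), (7, 290), (10, 84), (11, 17)]),
  (10, [(1, 269), (2, 2080), (3, 955), (7, 292), (9, 364), (10, 2)]),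
  (18, [(3, 480), (7, 36), (19, 24), (21, 2), (22, 89), (33, 17)]),
  (9, [(1, 314), (2, 3656), (3, 1884), (4, 183), (7, 540), (9, 552)]),
  (44, [(2, 13056), (3, 16222), (8, 1949), (9, 972), (10, 775), (17, 364)]),
  (11, [(2, 1644), (3, 953), (9, 376), (19, 344)]),
  (1, [(1, 35), (2, 668), (3, 300), (7, 104), (9, 96), (10, 9)]),
  (352, [(2, 66720), (3, 50354), (9, 10408), (17, 891), (19, 11872), (21, 99)]),
  (614, [(1, 57378), (6, 83600), (12, 4716), (13, 393), (15, 56068), (16, 60067)]),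
  (1, [(43, 1)]), (1, [(44, 1)]),
  (2, [(1, 216), (2, 2516), (3, 1325), (7, 409), (9, 372), (10, 43)]),
  (1, [(1, 401), (2, 1476), (3, 500), (7, 394), (9, 192), (10, 13)]), (1, [(45, 1)]),
  (3, [(1, 2860), (3, 6836), (7, 898), (10, 216), (11, 37)]),
  (88, [(2, 96752), (3, 139094), (8, 13923), (9, 10884), (10, 6565), (17, 2028)]),
  (28, [(3, 13950), (9, 63128), (15, 5040), (17, 2025), (21, 225), (28, 180)]),
  (36, [(1, 8515), (2, 70000), (3, 32199), (4, 2346), (7, 11610), (9, 10500)]),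
  (756, [(5, 564294), (11, 11371), (14, 22606), (17, 969348), (21, 2941), (24, 94826)]),
  (1, [(42, 1)]),
  (22, [(2, 167016), (3, 246772), (8, 24249), (9, 20052), (10, 11645), (17, 3264)]),
  (9, [(1, 65656), (3, 157892), (7, 20530), (10, 4974), (11, 859)]),
  (1760, [(2, 8077920), (3, 6594158), (9, 981976), (17, 155925), (19, 1322528), (21, 17325)]),
  (1, [(46, 1)]), (1, [(1, 1994), (2, 20784), (3, 8500), (7, 3661), (9, 2928), (10, 242)]),
  (9, [(1, 30970), (2, 282400), (3, 135492), (4, 11643), (7, 45630), (9, 42000)]),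
  (1, [(47, 1)]),
  (22, [(2, 2233368), (3, 3188816), (8, 321597), (9, 246996), (10, 150565), (17, 47592)]),
  (1, [(1, 45647), (2, 476092), (3, 198425), (7, 83553), (9, 67284), (10, 5716)])]

theorem certifies_certNegBT : Certifies matNegBT genK genZ certNegBT := by
  decide +kernel

/-- Certificate that `-B` maps `dirT` into `Z`. -/
def certDirZ : List (ℕ × List (ℕ × ℕ)) := [
  (1, [(3, 4)])]

theorem certifies_certDirZ : Certifies (-matB) [dirT] genZ certDirZ := by
  decide +kernel

/-- Certificate that `-B` maps `Z` into itself. -/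
def certNegB : List (ℕ × List (ℕ × ℕ)) := [
  (1, [(0, 1)]), (1, [(0, 1), (1, 1)]), (60, [(0, 44), (1, 105), (10, 5), (11, 3)]),
  (1800, [(0, 691), (1, 1860), (4, 900), (10, 400), (11, 57), (12, 120)]),
  (450, [(0, 691), (1, 1860), (4, 450), (10, 400), (11, 57), (12, 120)]),
  (450, [(0, 241), (1, 960), (4, 900), (10, 400), (11, 57), (12, 120)]),
  (8100, [(0, 15941), (1, 24060), (9, 3600), (10, 8900), (11, 207), (12, 3720)]),
  (900, [(0, 1517), (1, 4620), (4, 1800), (10, 800), (11, 159), (12, 240)]),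
  (600, [(0, 1799), (1, 5340), (4, 1500), (10, 1000), (11, 173), (12, 280)]),
  (3600, [(0, 14267), (1, 26220), (9, 3600), (10, 7400), (11, 309), (12, 3240)]),
  (10, [(0, 117), (1, 300), (10, 10), (11, 9)]), (1, [(0, 20), (1, 40), (11, 1)]),
  (6, [(0, 59), (1, 126), (10, 20), (11, 3), (12, 6)]), (5, [(0, 206), (1, 350), (11, 7)]),
  (486, [(0, 4913), (1, 7356), (9, 1440), (10, 2156), (11, 45), (12, 1056)]),
  (19440, [(0, 240233), (1, 418980), (9, 57600), (10, 117560), (11, 4311), (12, 51960)]),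
  (4860, [(0, 92191), (1, 144780), (9, 20160), (10, 44440), (11, 1197), (12, 19320)]),
  (6075, [(0, 102688), (1, 196530), (9, 28800), (10, 55000), (11, 2601), (12, 24360)]),
  (45, [(0, 691), (1, 1860), (4, 900), (10, 355), (11, 57), (12, 120)]),
  (3600, [(0, 72271), (1, 208860), (4, 50400), (10, 31000), (11, 6417), (12, 8520)]),
  (3, [(0, 149), (1, 366), (10, 20), (11, 12)]),
  (30, [(0, 811), (1, 3060), (10, 400), (11, 87), (12, 120)]),
  (300, [(0, 8393), (1, 25380), (4, 6600), (10, 4200), (11, 811), (12, 1160)]),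
  (30, [(0, 2983), (1, 7500), (10, 280), (11, 231)]),
  (24300, [(0, 1167169), (1, 1696740), (9, 331200), (10, 651400), (11, 8163), (12, 291480)]),
  (10, [(0, 2197), (1, 4010), (11, 89)]),
  (60, [(0, 4633), (1, 12780), (10, 1600), (11, 411), (12, 360)]),
  (60, [(0, 8501), (1, 22020), (10, 920), (11, 687)]),
  (6075, [(0, 455858), (1, 828480), (9, 111600), (10, 225950), (11, 9441), (12, 99660)]),
  (15, [(0, 2753), (1, 6705), (10, 875), (11, 201), (12, 210)]),
  (24300, [(0, 4606417), (1, 6755820), (9, 1281600), (10, 2369200), (11, 31059), (12, 1085640)]),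
  (16200, [(0, 3047627), (1, 5847420), (9, 878400), (10, 1687400), (11, 80829), (12, 742440)]),
  (75, [(0, 12316), (1, 34560), (4, 16650), (10, 6700), (11, 1107), (12, 2220)]),
  (300, [(0, 66673), (1, 200580), (4, 52800), (10, 33000), (11, 6371), (12, 9160)]),
  (30, [(0, 31193), (1, 80160), (10, 3560), (11, 2541)]),
  (12150, [(0, 6441539), (1, 10050690), (9, 1807200), (10, 3254150), (11, 67653), (12, 1495380)]),
  (15, [(0, 14464), (1, 37440), (10, 5350), (11, 1113), (12, 1380)]),
  (12150, [(0, 8556809), (1, 13980540), (9, 2455200), (10, 4349900), (11, 119493), (12, 1994880)]),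
  (60, [(0, 112229), (1, 272340), (10, 40100), (11, 7743), (12, 10680)]),
  (2700, [(0, 3792803), (1, 6256380), (9, 1094400), (10, 1934300), (11, 55881), (12, 886260)]),
  (225, [(0, 287662), (1, 809520), (4, 391050), (10, 157600), (11, 26049), (12, 52140)]),
  (48600, [(0, 101023541), (1, 158979360), (9, 28396800), (10, 51052100), (11, 1118007), (12, 23448720)]),
  (450, [(0, 2299543), (1, 6919980), (4, 1820250), (10, 1138600), (11, 219861), (12, 315960)]),
  (225, [(0, 2207471), (1, 6211560), (4, 3000150), (10, 1209050), (11, 199842), (12, 400020)]),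
  (24300, [(0, 353729021), (1, 557208660), (9, 99460800), (10, 178826600), (11, 3938967), (12, 82123320)]),
  (24300, [(0, 533602081), (1, 880441260), (9, 154468800), (10, 273400600), (11, 7927587), (12, 125135520)]),
  (24300, [(0, 4649997883), (1, 7315017180), (9, 1306958400), (10, 2349773800), (11, 51349041), (12, 1079304360)]),
  (6075, [(0, 3068311882), (1, 5063214345), (9, 888123600), (10, 1571716825), (11, 45592614), (12, 719415690)])]

theorem certifies_certNegB : Certifies (-matB) genZ genZ certNegB := by
  decide +kernel

/-- Certificate that `Z` is contained in `K`. -/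
def certZK : List (ℕ × List (ℕ × ℕ)) := [
  (2, [(0, 1), (10, 1)]), (4, [(0, 1), (10, 3)]), (8, [(0, 1), (7, 6), (10, 4), (16, 1)]),
  (60, [(0, 9), (7, 24), (10, 31), (14, 48), (16, 4)]),
  (45, [(0, 18), (5, 15), (7, 48), (10, 82), (14, 96), (16, 28)]),
  (15, [(0, 9), (7, 24), (10, 16), (14, 48), (16, 4)]),
  (180, [(0, 99), (5, 60), (7, 84), (10, 391), (14, 528), (16, 94)]),
  (15, [(0, 9), (7, 39), (10, 31), (14, 48), (16, 4)]),
  (180, [(0, 153), (5, 60), (7, 588), (10, 637), (14, 816), (16, 178)]),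
  (180, [(0, 171), (5, 75), (7, 456), (10, 779), (14, 1092), (16, 131)]),
  (4, [(0, 7), (7, 60), (10, 31), (16, 6)]), (2, [(0, 7), (7, 40), (10, 27)]),
  (6, [(0, 9), (5, 15), (7, 15), (10, 55), (14, 24), (16, 22)]),
  (1, [(0, 8), (7, 28), (10, 29)]), (3, [(0, 9), (7, 24), (10, 31), (14, 48), (16, 1)]),
  (12, [(0, 36), (5, 15), (7, 84), (10, 160), (14, 216), (16, 25)]),
  (90, [(0, 441), (5, 210), (7, 636), (10, 1829), (14, 2352), (16, 326)]),
  (45, [(0, 189), (5, 60), (7, 624), (10, 826), (14, 1248), (16, 124)]),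
  (12, [(0, 69), (7, 228), (10, 245), (14, 384), (16, 14)]),
  (60, [(0, 297), (5, 75), (7, 1392), (10, 1313), (14, 1464), (16, 287)]),
  (1, [(0, 10), (7, 60), (10, 31), (16, 10)]),
  (3, [(5, 30), (7, 30), (10, 92), (14, 48), (16, 17), (21, 18)]),
  (90, [(0, 657), (5, 210), (7, 3012), (10, 2873), (14, 3504), (16, 722)]),
  (2, [(0, 33), (7, 252), (10, 129), (16, 28)]),
  (30, [(0, 429), (5, 150), (7, 624), (10, 1601), (14, 2448), (16, 254)]),
  (4, [(0, 163), (7, 712), (10, 609)]),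
  (2, [(0, 23), (5, 30), (7, 144), (10, 125), (14, 48), (16, 64)]),
  (1, [(0, 23), (7, 183), (10, 92), (16, 23)]),
  (45, [(0, 801), (5, 330), (7, 2136), (10, 3649), (14, 4992), (16, 571)]),
  (6, [(0, 186), (5, 210), (7, 768), (10, 905), (14, 336), (16, 413)]),
  (30, [(0, 1647), (5, 450), (7, 2832), (10, 6193), (14, 9264), (16, 772)]),
  (90, [(0, 4338), (5, 1365), (7, 14268), (10, 18412), (14, 28536), (16, 2923)]),
  (10, [(0, 631), (7, 2196), (10, 2199), (14, 3552), (16, 156)]),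
  (90, [(0, 5229), (5, 1590), (7, 23844), (10, 22861), (14, 27888), (16, 5554)]),
  (1, [(0, 178), (7, 1338), (10, 667), (16, 178)]),
  (30, [(0, 4473), (5, 1050), (7, 9588), (10, 17162), (14, 25776), (16, 1973)]),
  (3, [(0, 414), (5, 690), (7, 1932), (10, 2530), (14, 1104), (16, 1237)]),
  (5, [(0, 983), (5, 200), (7, 2448), (10, 3777), (14, 5776), (16, 423)]),
  (12, [(0, 3429), (5, 5340), (7, 12252), (10, 19805), (14, 8544), (16, 9182)]),
  (30, [(0, 11757), (5, 2325), (7, 30117), (10, 45158), (14, 69384), (16, 5057)]),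
  (30, [(0, 14817), (7, 51612), (10, 51433), (14, 83424), (16, 3712)]),
  (60, [(0, 34956), (5, 8100), (7, 76836), (10, 134489), (14, 202272), (16, 15431)]),
  (15, [(0, 20034), (5, 6105), (7, 91404), (10, 87596), (14, 106848), (16, 21314)]),
  (15, [(0, 56838), (7, 197988), (10, 197332), (14, 320016), (16, 14233)]),
  (30, [(0, 122361), (5, 28350), (7, 269616), (10, 470909), (14, 708432), (16, 54086)]),
  (30, [(0, 184371), (5, 36600), (7, 472026), (10, 706199), (14, 1088352), (16, 79946)]),
  (30, [(0, 1609203), (5, 373050), (7, 3533568), (10, 6190507), (14, 9309936), (16, 710278)]),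
  (30, [(0, 4239873), (5, 841050), (7, 10859388), (10, 16242412), (14, 25028976), (16, 1837423)])]

theorem certifies_certZK : Certifies 1 genZ genK certZK := by
  decide +kernel

/-- Certificate that `B⁻¹ * T` maps `K` into `W`. -/
def certBInvT : List (ℕ × List (ℕ × ℕ)) := [
  (1, [(7, 1)]), (248, [(0, 9), (2, 36), (4, 112), (7, 167), (8, 48), (9, 4)]), (1, [(10, 1)]),
  (1, [(6, 1)]), (1, [(8, 1)]), (1, [(3, 1)]),
  (167, [(1, 144), (5, 59), (7, 115), (10, 239), (14, 45), (15, 4)]),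
  (248, [(0, 257), (2, 36), (4, 360), (7, 167), (8, 48), (9, 4)]), (1, [(14, 1)]),
  (1, [(11, 1)]), (1, [(0, 2), (4, 2), (7, 1)]),
  (6, [(0, 5), (1, 12), (2, 2), (4, 6), (6, 6), (7, 3)]),
  (12, [(0, 11), (1, 12), (2, 2), (4, 18), (6, 12), (7, 9)]), (1, [(12, 1)]),
  (24, [(0, 37), (1, 42), (2, 13), (4, 75), (6, 30), (7, 33)]),
  (94, [(0, 397), (1, 480), (6, 320), (7, 167), (8, 1040), (9, 14)]),
  (1, [(0, 5), (2, 1), (4, 10), (7, 5)]), (1, [(18, 1)]),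
  (48, [(0, 211), (1, 276), (2, 82), (4, 438), (6, 180), (7, 201)]),
  (167, [(1, 2016), (5, 826), (7, 2612), (10, 2177), (14, 630), (15, 56)]),
  (68, [(0, 893), (1, 792), (2, 104), (7, 463), (8, 3312), (9, 72)]),
  (40, [(0, 385), (2, 90), (3, 90), (4, 742), (7, 355), (9, 6)]),
  (1, [(0, 8), (1, 4), (2, 2), (4, 16), (6, 4), (7, 7)]),
  (12, [(0, 79), (1, 156), (2, 34), (4, 138), (6, 84), (7, 69)]), (1, [(24, 1)]), (1, [(20, 1)]),
  (4, [(0, 77), (1, 140), (2, 30), (4, 102), (6, 60), (7, 47)]),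
  (62, [(0, 1082), (2, 515), (4, 934), (7, 2197), (8, 7920), (9, 226)]), (1, [(26, 1)]),
  (62, [(0, 367), (2, 1158), (4, 1164), (7, 3889), (8, 10224), (9, 356)]), (1, [(25, 1)]),
  (1, [(27, 1)]), (2, [(0, 55), (1, 60), (2, 20), (4, 118), (6, 44), (7, 53)]), (1, [(28, 1)]),
  (496, [(0, 2599), (2, 19820), (4, 18648), (7, 65889), (8, 162000), (9, 5812)]),
  (167, [(1, 15840), (5, 6490), (7, 21668), (10, 16771), (14, 4950), (15, 440)]),
  (176, [(2, 173), (5, 9188), (7, 28444), (8, 69552), (9, 2980), (10, 511)]),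
  (4, [(0, 291), (1, 420), (2, 110), (4, 466), (6, 180), (7, 221)]),
  (12, [(0, 617), (1, 1092), (2, 254), (4, 1158), (6, 636), (7, 579)]),
  (124, [(0, 7549), (2, 4435), (4, 7398), (7, 17774), (8, 61920), (9, 1812)]), (1, [(32, 1)]),
  (20, [(0, 2235), (2, 490), (3, 630), (4, 4034), (7, 1905), (9, 42)]),
  (8, [(0, 777), (1, 364), (2, 174), (4, 1466), (6, 364), (7, 643)]),
  (12, [(0, 1087), (1, 1884), (2, 442), (4, 2058), (6, 1116), (7, 1029)]),
  (4, [(0, 759), (1, 508), (2, 186), (4, 1370), (6, 388), (7, 613)]),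
  (4, [(0, 829), (1, 860), (2, 280), (4, 1474), (6, 420), (7, 689)]),
  (12, [(0, 2377), (1, 2580), (2, 814), (4, 4854), (6, 1920), (7, 2139)]),
  (1, [(0, 295), (1, 208), (2, 85), (4, 542), (6, 120), (7, 251)]),
  (6, [(0, 1355), (1, 1452), (2, 464), (4, 2790), (6, 1092), (7, 1233)]), (1, [(33, 1)]),
  (167, [(1, 121536), (5, 49796), (7, 165864), (10, 128737), (14, 37980), (15, 3376)]),
  (62, [(0, 26189), (2, 15600), (4, 26048), (7, 62519), (8, 216720), (9, 6342)]),
  (8, [(0, 4787), (1, 3080), (2, 1330), (4, 8822), (6, 1860), (7, 4077)]),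
  (1, [(0, 783), (1, 320), (2, 180), (4, 1423), (6, 240), (7, 663)]),
  (248, [(0, 23871), (2, 151780), (4, 149832), (7, 530401), (8, 1262160), (9, 44668)]),
  (4, [(0, 3527), (2, 762), (3, 990), (4, 6314), (7, 2981), (9, 66)]),
  (4, [(0, 3264), (1, 3240), (2, 1085), (4, 5854), (6, 1620), (7, 2729)]), (1, [(34, 1)]),
  (48, [(0, 44149), (1, 26148), (2, 10438), (4, 80142), (6, 20628), (7, 35931)]), (1, [(36, 1)]),
  (12, [(0, 14195), (1, 25260), (2, 5858), (4, 26562), (6, 14652), (7, 13281)]),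
  (4, [(0, 22873), (1, 22620), (2, 7590), (4, 41038), (6, 11340), (7, 19123)]),
  (10, [(0, 67625), (2, 14620), (3, 18990), (4, 121102), (7, 57175), (9, 1266)]),
  (12, [(0, 62101), (1, 66516), (2, 21334), (4, 128190), (6, 49980), (7, 56679)]),
  (62, [(0, 349147), (2, 203460), (4, 340264), (7, 816997), (8, 2850480), (9, 83346)]),
  (1, [(0, 9452), (1, 6065), (2, 2595), (4, 17277), (6, 3660), (7, 7982)]),
  (4, [(0, 59239), (1, 37028), (2, 14218), (4, 107062), (6, 28508), (7, 48041)]),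
  (62, [(0, 133862), (2, 874805), (4, 859914), (7, 3047047), (8, 7258320), (9, 257226)]),
  (4, [(0, 300419), (1, 298740), (2, 99930), (4, 538634), (6, 149220), (7, 251129)]),
  (4, [(0, 869289), (1, 557100), (2, 238700), (4, 1589794), (6, 336420), (7, 734489)])]

theorem certifies_certBInvT : Certifies matBInvT genK genW certBInvT := by
  decide +kernel

/-- Certificate that `B⁻¹` maps `dirT` into `W`. -/
def certDirW : List (ℕ × List (ℕ × ℕ)) := [
  (1, [(0, 1), (4, 2), (7, 1)])]

theorem certifies_certDirW : Certifies matBInv [dirT] genW certDirW := by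
  decide +kernel

/-- Certificate that `-B⁻¹` maps `W` into itself. -/
def certNegBInv : List (ℕ × List (ℕ × ℕ)) := [
  (1, [(0, 1), (4, 2)]), (1, [(0, 1), (1, 1), (4, 1)]), (1, [(0, 6), (1, 12), (2, 1), (4, 4)]),
  (30, [(0, 25), (1, 40), (2, 10), (4, 34), (7, 15), (9, 2)]), (1, [(4, 1)]),
  (2, [(0, 24), (1, 42), (2, 3), (4, 17)]),
  (60, [(0, 95), (1, 220), (2, 50), (4, 106), (7, 45), (9, 8)]),
  (15, [(0, 160), (1, 320), (2, 40), (4, 98), (7, 15), (9, 4)]),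
  (240, [(0, 1555), (1, 4040), (2, 700), (4, 1076), (7, 405), (9, 88)]),
  (1, [(0, 20), (1, 60), (2, 10), (4, 10), (9, 1)]),
  (3, [(0, 103), (1, 248), (2, 37), (4, 62), (7, 15), (9, 4)]),
  (12, [(0, 216), (1, 572), (2, 102), (4, 155), (7, 60), (9, 13)]),
  (5, [(0, 95), (1, 250), (2, 50), (4, 84), (7, 35), (9, 7)]),
  (1, [(0, 132), (1, 210), (2, 14), (4, 103)]),
  (15, [(0, 615), (1, 1520), (2, 240), (4, 386), (7, 120), (9, 28)]),
  (1, [(0, 85), (1, 240), (2, 35), (4, 40), (9, 3)]),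
  (2, [(0, 515), (1, 1320), (2, 175), (4, 250), (9, 14)]),
  (1, [(0, 366), (1, 852), (2, 105), (4, 196), (9, 8)]),
  (15, [(0, 1775), (1, 4680), (2, 815), (4, 1224), (7, 465), (9, 102)]),
  (2, [(0, 1480), (1, 3375), (2, 410), (4, 810), (9, 31)]),
  (15, [(0, 2260), (1, 5990), (2, 1180), (4, 1946), (7, 810), (9, 163)]),
  (1, [(0, 1032), (1, 1626), (2, 108), (4, 815)]),
  (1, [(0, 920), (1, 1920), (2, 220), (4, 575), (9, 16)]),
  (4, [(0, 4075), (1, 10320), (2, 1355), (4, 1990), (9, 108)]),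
  (30, [(0, 14725), (1, 35620), (2, 5530), (4, 9247), (7, 2745), (9, 641)]),
  (6, [(0, 1585), (1, 4200), (2, 826), (4, 1362), (7, 567), (9, 114)]),
  (15, [(0, 13900), (1, 33550), (2, 5290), (4, 8986), (7, 2700), (9, 623)]),
  (12, [(0, 9871), (1, 25604), (2, 4426), (4, 6818), (7, 2565), (9, 556)]),
  (15, [(0, 14080), (1, 36580), (2, 6325), (4, 9718), (7, 3660), (9, 794)]),
  (1, [(0, 7918), (1, 12480), (2, 829), (4, 6250)]),
  (1, [(0, 7140), (1, 18060), (2, 2370), (4, 3490), (9, 189)]),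
  (1, [(0, 11585), (1, 26295), (2, 3205), (4, 6430), (9, 244)]),
  (120, [(0, 557375), (1, 1342560), (2, 209690), (4, 356046), (7, 104535), (9, 24438)]),
  (30, [(0, 103975), (1, 275520), (2, 54310), (4, 89622), (7, 37305), (9, 7506)]),
  (15, [(0, 323705), (1, 841690), (2, 145550), (4, 223276), (7, 84105), (9, 18263)]),
  (1, [(0, 93750), (1, 237540), (2, 31200), (4, 45770), (9, 2487)]),
  (30, [(0, 2219875), (1, 5348980), (2, 838270), (4, 1424968), (7, 421155), (9, 98054)]),
  (2, [(0, 532985), (1, 1209720), (2, 147385), (4, 295670), (9, 11214)])]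

theorem certifies_certNegBInv : Certifies (-matBInv) genW genW certNegBInv := by
  decide +kernel

/-- Certificate that `W` is contained in `K`. -/
def certWK : List (ℕ × List (ℕ × ℕ)) := [
  (1, [(0, 1)]), (1, [(1, 1)]), (1, [(2, 1)]), (1, [(5, 1)]), (2, [(0, 1), (10, 1)]),
  (1, [(6, 1)]), (1, [(3, 1), (5, 1)]), (1, [(8, 1)]), (16, [(3, 22), (5, 15), (9, 8), (13, 3)]),
  (1, [(15, 1)]), (3, [(2, 3), (3, 20), (4, 32)]), (4, [(3, 18), (5, 11), (9, 4), (13, 3)]),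
  (1, [(3, 8), (5, 6), (13, 1)]), (1, [(19, 1)]),
  (6, [(2, 3), (3, 44), (4, 24), (5, 19), (9, 20)]), (1, [(20, 1)]), (1, [(27, 1)]),
  (1, [(29, 1)]), (2, [(3, 50), (5, 31), (9, 16), (13, 9)]), (1, [(34, 1)]),
  (1, [(3, 56), (5, 44), (13, 9)]), (1, [(35, 1)]), (1, [(36, 1)]), (1, [(39, 1)]),
  (6, [(2, 45), (3, 440), (4, 520), (5, 233), (9, 160)]), (1, [(3, 96), (5, 77), (13, 16)]),
  (3, [(2, 45), (3, 494), (4, 520), (5, 260), (9, 124)]),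
  (1, [(3, 167), (5, 120), (9, 64), (13, 24)]), (2, [(3, 378), (5, 271), (9, 144), (13, 57)]),
  (1, [(50, 1)]), (1, [(51, 1)]), (1, [(54, 1)]),
  (24, [(2, 1935), (3, 18980), (4, 22840), (5, 9209), (9, 4420)]),
  (1, [(3, 1296), (5, 1015), (13, 206)]), (1, [(3, 4352), (5, 3090), (9, 1648), (13, 663)]),
  (1, [(64, 1)]), (6, [(2, 7605), (3, 77240), (4, 89320), (5, 38297), (9, 17860)]),
  (1, [(67, 1)])]

theorem certifies_certWK : Certifies 1 genW genK certWK := by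
  decide +kernel

/-- Certificate that `matE` maps `K` into itself. -/
def certE : List (ℕ × List (ℕ × ℕ)) := [
  (1, [(10, 1)]), (1, [(7, 1)]), (1, [(16, 1)]), (1, [(11, 1)]), (1, [(14, 1)]), (1, [(12, 1)]),
  (1, [(21, 1)]), (1, [(1, 1)]), (1, [(22, 1)]), (1, [(18, 1)]), (1, [(0, 1)]), (1, [(3, 1)]),
  (1, [(5, 1)]), (1, [(23, 1)]), (1, [(4, 1)]), (1, [(26, 1)]), (1, [(2, 1)]), (1, [(32, 1)]),
  (1, [(9, 1)]), (1, [(41, 1)]), (1, [(37, 1)]), (1, [(6, 1)]), (1, [(8, 1)]), (1, [(13, 1)]),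
  (1, [(42, 1)]), (1, [(38, 1)]), (1, [(15, 1)]), (1, [(45, 1)]), (1, [(44, 1)]), (1, [(47, 1)]),
  (1, [(43, 1)]), (1, [(46, 1)]), (1, [(17, 1)]), (1, [(48, 1)]), (1, [(52, 1)]), (1, [(55, 1)]),
  (1, [(53, 1)]), (1, [(20, 1)]), (1, [(25, 1)]), (1, [(56, 1)]), (1, [(58, 1)]), (1, [(19, 1)]),
  (1, [(24, 1)]), (1, [(30, 1)]), (1, [(28, 1)]), (1, [(27, 1)]), (1, [(31, 1)]), (1, [(29, 1)]),
  (1, [(33, 1)]), (1, [(60, 1)]), (1, [(62, 1)]), (1, [(61, 1)]), (1, [(34, 1)]), (1, [(36, 1)]),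
  (1, [(65, 1)]), (1, [(35, 1)]), (1, [(39, 1)]), (1, [(63, 1)]), (1, [(40, 1)]), (1, [(66, 1)]),
  (1, [(49, 1)]), (1, [(51, 1)]), (1, [(50, 1)]), (1, [(57, 1)]), (1, [(68, 1)]), (1, [(54, 1)]),
  (1, [(59, 1)]), (1, [(69, 1)]), (1, [(64, 1)]), (1, [(67, 1)])]

theorem certifies_certE : Certifies matE genK genK certE := by
  decide +kernel

/-- An invertible integer matrix as an element of the rational general linear group. -/
def glOfInverse (M N : Matrix (Fin 6) (Fin 6) ℤ) (hMN : M * N = 1) (hNM : N * M = 1) :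
    GL (Fin 6) ℚ :=
  Units.map (Int.castRingHom ℚ).mapMatrix.toMonoidHom ⟨M, N, hMN, hNM⟩

/-- The companion matrix of `(x + 1) ^ 6` as an invertible matrix. -/
def glB : GL (Fin 6) ℚ := glOfInverse matB matBInv (by decide +kernel) (by decide +kernel)

/-- The transvection `T` as an invertible matrix. -/
def glT : GL (Fin 6) ℚ := glOfInverse matT matTInv (by decide +kernel) (by decide +kernel)

/-- The involution inverting both `T` and `B` as an invertible matrix. -/
def glE : GL (Fin 6) ℚ := glOfInverse matE matE (by decide +kernel) (by decide +kernel)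

theorem glE_mul_self : glE * glE = 1 := Units.ext <| by
  change (Int.castRingHom ℚ).mapMatrix matE * (Int.castRingHom ℚ).mapMatrix matE = 1
  rw [← map_mul, show matE * matE = 1 by decide +kernel, map_one]

theorem glE_mul_glT_mul_glE : glE * glT * glE = glT⁻¹ := Units.ext <| by
  change (Int.castRingHom ℚ).mapMatrix matE * (Int.castRingHom ℚ).mapMatrix matT *
    (Int.castRingHom ℚ).mapMatrix matE = (Int.castRingHom ℚ).mapMatrix matTInv
  rw [← map_mul, ← map_mul, show matE * matT * matE = matTInv by decide +kernel]

theorem glE_mul_glB_mul_glE : glE * glB * glE = glB⁻¹ := Units.ext <| by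
  change (Int.castRingHom ℚ).mapMatrix matE * (Int.castRingHom ℚ).mapMatrix matB *
    (Int.castRingHom ℚ).mapMatrix matE = (Int.castRingHom ℚ).mapMatrix matBInv
  rw [← map_mul, ← map_mul, show matE * matB * matE = matBInv by decide +kernel]

theorem companionMatrix_X_add_one_pow_six :
    companionMatrix 6 ((X + 1) ^ 6 : ℚ[X]) = ratMat matB := by
  ext i j
  simp only [companionMatrix, of_apply, coeff_X_add_one_pow]
  fin_cases i <;> fin_cases j <;> simp [matB, ratMat, Nat.choose]

theorem ratMat_matB_eq_mul_companionMatrix :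
    ratMat matB = ratMat matT * companionMatrix 6 ((X - 1) ^ 6 : ℚ[X]) := by
  have : companionMatrix 6 ((X - 1) ^ 6 : ℚ[X]) = ratMat (matTInv * matB) := by
    ext i j
    simp only [companionMatrix, of_apply, sub_eq_add_neg,
      show (X + -1 : ℚ[X]) = X + C (-1) by simp, coeff_X_add_C_pow]
    fin_cases i <;> fin_cases j <;> norm_num [matB, matTInv, ratMat, Nat.choose]
  rw [this, ratMat, ratMat, ratMat, ← Matrix.map_mul, ← mul_assoc,
    show matT * matTInv = 1 by decide +kernel, one_mul]

/-- The action of the general linear group on column vectors. -/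
def glAction : GL (Fin 6) ℚ →* ((Fin 6 → ℚ) ≃ₗ[ℚ] (Fin 6 → ℚ)) :=
  (LinearMap.GeneralLinearGroup.generalLinearEquiv ℚ (Fin 6 → ℚ)).toMonoidHom.comp
    Matrix.GeneralLinearGroup.toLin.toMonoidHom

theorem glAction_glT (v : Fin 6 → ℚ) : glAction glT v = ratMat matT *ᵥ v := rfl

/-- The coefficients of the functional separating the translates of the cone under `T`. -/
def separator : Fin 6 → ℤ := ![-137, 12, 3, 2, 3, 12]

/-- The linear functional with coefficients `separator`, scaled so that it takes the value `2`
on the direction of `T`. -/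
def separatingFunctional : (Fin 6 → ℚ) →ₗ[ℚ] ℚ :=
  (184 : ℚ)⁻¹ • ∑ i, (separator i : ℚ) • LinearMap.proj i

theorem separatingFunctional_ratVec (g : Fin 6 → ℤ) :
    separatingFunctional (ratVec g) = (184 : ℚ)⁻¹ * ((separator ⬝ᵥ g : ℤ) : ℚ) := by
  simp [separatingFunctional, ratVec, dotProduct, LinearMap.sum_apply]

theorem separator_bounds :
    ∀ g ∈ genK, separator ⬝ᵥ g ≤ 184 * g 0 ∧ -(184 * g 0) ≤ separator ⬝ᵥ g := by
  decide +kernel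

/-- The inverse, multiplied by `96`, of the matrix whose columns are the first six vectors
of `genK`. -/
def spanCoeffs : Matrix (Fin 6) (Fin 6) ℤ :=
  !![13, 15, 1, -13, -11, 23;
     6, 6, 6, 6, 6, 6;
     1, -3, 1, 5, 1, -19;
     -60, -28, 36, 36, -28, -60;
     72, 8, -24, -24, 8, 72;
     -12, 6, 0, -6, 12, -18]

theorem spanCoeffs_spec : (of fun i j : Fin 6 => genK.getD j 0 i) * spanCoeffs = 96 := by
  decide +kernel

theorem core_listCone_genK_nonempty : (listCone genK).core.Nonempty := by
  refine PointedCone.core_nonempty_of_spanning (fun j : Fin 6 => ratVec (genK.getD j 0))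
    (fun j => ratVec_mem_listCone ?_) fun u => ⟨(96 : ℚ)⁻¹ • (ratMat spanCoeffs *ᵥ u), ?_⟩
  · rw [List.getD_eq_getElem _ _ (j.isLt.trans (by decide +kernel))]
    exact List.getElem_mem _
  · have hmul : ratMat (of fun i j : Fin 6 => genK.getD j 0 i) * ratMat spanCoeffs = 96 := by
      rw [ratMat, ratMat, ← Matrix.map_mul, spanCoeffs_spec]
      exact map_ofNat (Int.castRingHom ℚ).mapMatrix 96
    have hu := congrArg (fun M => (96 : ℚ)⁻¹ • (M *ᵥ u)) hmul
    simp only [← mulVec_mulVec] at hu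
    rw [show (96 : Matrix (Fin 6) (Fin 6) ℚ) = (96 : ℚ) • 1 by
      ext i j; simp [Matrix.one_apply, Matrix.ofNat_apply], smul_mulVec, one_mulVec,
      inv_smul_smul₀ (by norm_num), ← mulVec_smul, mulVec_eq_sum] at hu
    refine Eq.trans (Finset.sum_congr rfl fun j _ => ?_) hu
    rw [op_smul_eq_smul]
    rfl

theorem injective_lift_glT_glB : Function.Injective (FreeGroup.lift ![glT, glB]) := by
  have hneg {M : Matrix (Fin 6) (Fin 6) ℤ} (v : Fin 6 → ℚ) :
      ratMat (-M) *ᵥ v = -(ratMat M *ᵥ v) := by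
    rw [← neg_mulVec]
    exact congrArg (· *ᵥ v) (map_neg (Int.castRingHom ℚ).mapMatrix M)
  have hmul {M N : Matrix (Fin 6) (Fin 6) ℤ} (v : Fin 6 → ℚ) :
      ratMat (M * N) *ᵥ v = ratMat M *ᵥ (ratMat N *ᵥ v) := by
    rw [mulVec_mulVec]
    exact congrArg (· *ᵥ v) (map_mul (Int.castRingHom ℚ).mapMatrix M N)
  have hone (v : Fin 6 → ℚ) : ratMat 1 *ᵥ v = v := by
    rw [show ratMat 1 = 1 from map_one (Int.castRingHom ℚ).mapMatrix, one_mulVec]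
  have hdir : ratVec dirT ∈ listCone [dirT] := ratVec_mem_listCone (List.mem_singleton_self _)
  have hinj := injective_lift_pair_of_invariant_cones (glAction glT) (glAction glB)
    (glAction glE) (ratVec dirT) (LinearMap.proj 0) separatingFunctional
    (listCone genK) (listCone genZ) (listCone genW)
    (fun v => by
      rw [glAction_glT]
      ext i
      fin_cases i <;>
        simp [matT, ratMat, ratVec, dirT, mulVec, dotProduct, Fin.sum_univ_six] <;> ring)
    (by simp [ratVec, dirT])
    (by
      rw [separatingFunctional_ratVec, show separator ⬝ᵥ dirT = 368 by decide +kernel]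
      norm_num)
    (by rw [← map_mul, glE_mul_self, map_one])
    (by rw [← map_mul, ← map_mul, glE_mul_glT_mul_glE, map_inv])
    (by rw [← map_mul, ← map_mul, glE_mul_glB_mul_glE, map_inv])
    core_listCone_genK_nonempty
    (nonneg_of_mem_listCone _ fun g hg => by
      have h : ((separator ⬝ᵥ g : ℤ) : ℚ) ≤ 184 * g 0 := by
        exact_mod_cast (separator_bounds g hg).1
      rw [LinearMap.sub_apply, separatingFunctional_ratVec, LinearMap.proj_apply, ratVec]
      linarith)
    (nonneg_of_mem_listCone _ fun g hg => by
      have h : -(184 * (g 0 : ℚ)) ≤ ((separator ⬝ᵥ g : ℤ) : ℚ) := by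
        exact_mod_cast (separator_bounds g hg).2
      rw [LinearMap.add_apply, separatingFunctional_ratVec, LinearMap.proj_apply, ratVec]
      linarith)
    (fun v hv => certifies_certE.mulVec_mem v hv)
    (fun v hv => by
      have := certifies_certNegBT.mulVec_mem v hv
      rwa [show matNegBT = -(matB * matT) by decide +kernel, hneg, hmul] at this)
    (by
      have := certifies_certDirZ.mulVec_mem _ hdir
      rwa [hneg] at this)
    (fun v hv => by
      have := certifies_certNegB.mulVec_mem v hv
      rwa [hneg] at this)
    (fun v hv => by
      have := certifies_certZK.mulVec_mem v hv
      rwa [hone] at this)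
    (fun v hv => by
      have := certifies_certBInvT.mulVec_mem v hv
      rwa [show matBInvT = matBInv * matT by decide +kernel, hmul] at this)
    (certifies_certDirW.mulVec_mem _ hdir)
    (fun v hv => by
      have := certifies_certNegBInv.mulVec_mem v hv
      rwa [hneg] at this)
    (fun v hv => by
      have := certifies_certWK.mulVec_mem v hv
      rwa [hone] at this)
  have hcomp : FreeGroup.lift ![glAction glT, glAction glB] =
      glAction.comp (FreeGroup.lift ![glT, glB]) := by
    ext1 i
    fin_cases i <;> simp
  rw [hcomp, MonoidHom.coe_comp] at hinj
  exact hinj.of_comp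

end Hypergeometric

theorem thm_A1 (A B : GL (Fin 6) ℚ)
    (hA : (A : Matrix (Fin 6) (Fin 6) ℚ) = companionMatrix 6 ((X - 1) ^ 6))
    (hB : (B : Matrix (Fin 6) (Fin 6) ℚ) = companionMatrix 6 ((X + 1) ^ 6)) :
    Function.Injective (FreeGroup.lift ![B * A⁻¹, B] : FreeGroup (Fin 2) →* GL (Fin 6) ℚ) := by
  have hBeq : B = Hypergeometric.glB :=
    Units.ext (hB.trans Hypergeometric.companionMatrix_X_add_one_pow_six)
  have hT : Hypergeometric.glB = Hypergeometric.glT * A := Units.ext <| by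
    rw [Units.val_mul, hA]
    exact Hypergeometric.ratMat_matB_eq_mul_companionMatrix
  rw [hBeq, show Hypergeometric.glB * A⁻¹ = Hypergeometric.glT by rw [hT, mul_inv_cancel_right]]
  exact Hypergeometric.injective_lift_glT_glB
end

section
/- Let A be the companion matrix of f(x) = (x−1)⁶ and B the companion matrix of g(x) = (x+1)⁴(x²+1), regarded as elements of GL₆(ℚ), and set T = B·A⁻¹. Then T and B generate a free group of rank 2: the group homomorphism from the free group on two generators to GL₆(ℚ) sending the first generator to T and the second generator to B is injective. (This is the hypergeometric monodromy group of case A-3, with α = (0,0,0,0,0,0) and β = (1/2,1/2,1/2,1/2,1/4,3/4); in particular this group is isomorphic to ℤ ∗ ℤ.) -/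
open Matrix Polynomial

/-- Elements of the form `τ ^ n₁ * β ^ m₁ * ⋯ * τ ^ nₖ * β ^ mₖ * τ ^ n`, where all exponents except
possibly the last one are nonzero. -/
inductive IsAlternating {H : Type*} [Group H] (τ β : H) : H → Prop
  | zpow (n : ℤ) : IsAlternating τ β (τ ^ n)
  | step (n m : ℤ) (h : H) (hn : n ≠ 0) (hm : m ≠ 0) (hh : IsAlternating τ β h) :
      IsAlternating τ β (τ ^ n * (β ^ m * h))

theorem isAlternating_or_of_closure_eq_top {H : Type*} [Group H] {τ β : H}
    (hgen : Subgroup.closure {τ, β} = ⊤) (g : H) :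
    IsAlternating τ β g ∨ ∃ m : ℤ, m ≠ 0 ∧ ∃ h, IsAlternating τ β h ∧ g = β ^ m * h := by
  have hτ : ∀ k : ℤ, ∀ g : H,
      (IsAlternating τ β g ∨ ∃ m : ℤ, m ≠ 0 ∧ ∃ h, IsAlternating τ β h ∧ g = β ^ m * h) →
      (IsAlternating τ β (τ ^ k * g) ∨
        ∃ m : ℤ, m ≠ 0 ∧ ∃ h, IsAlternating τ β h ∧ τ ^ k * g = β ^ m * h) := by
    rintro k _ ((⟨n⟩ | ⟨n, m, h, hn, hm, hh⟩) | ⟨m, hm, h, hh, rfl⟩)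
    · exact Or.inl (by rw [← _root_.zpow_add]; exact .zpow _)
    · rw [← mul_assoc, ← _root_.zpow_add]
      by_cases h0 : k + n = 0
      · exact Or.inr ⟨m, hm, h, hh, by simp [h0]⟩
      · exact Or.inl (.step _ m h h0 hm hh)
    · by_cases h0 : k = 0
      · exact Or.inr ⟨m, hm, h, hh, by simp [h0]⟩
      · exact Or.inl (.step k m h h0 hm hh)
  have hβ : ∀ k : ℤ, ∀ g : H,
      (IsAlternating τ β g ∨ ∃ m : ℤ, m ≠ 0 ∧ ∃ h, IsAlternating τ β h ∧ g = β ^ m * h) →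
      (IsAlternating τ β (β ^ k * g) ∨
        ∃ m : ℤ, m ≠ 0 ∧ ∃ h, IsAlternating τ β h ∧ β ^ k * g = β ^ m * h) := by
    rintro k g (hg | ⟨m, hm, h, hh, rfl⟩)
    · by_cases h0 : k = 0
      · exact Or.inl (by simpa [h0] using hg)
      · exact Or.inr ⟨k, h0, g, hg, rfl⟩
    · rw [← mul_assoc, ← _root_.zpow_add]
      by_cases h0 : k + m = 0
      · exact Or.inl (by simpa [h0] using hh)
      · exact Or.inr ⟨_, h0, h, hh, rfl⟩
  have hg : g ∈ Subgroup.closure {τ, β} := hgen ▸ Subgroup.mem_top g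
  induction hg using Subgroup.closure_induction_left with
  | one => exact Or.inl (by simpa using IsAlternating.zpow (β := β) (τ := τ) 0)
  | mul_left x hx y _ ih =>
    rcases hx with rfl | rfl
    · simpa using hτ 1 y ih
    · simpa using hβ 1 y ih
  | inv_mul_cancel x hx y _ ih =>
    rcases hx with rfl | rfl
    · simpa using hτ (-1) y ih
    · simpa using hβ (-1) y ih

/-- A ping-pong criterion: `Y` is the table for `t`, and `P` is a set containing the fixed point `v`
of `t` that is avoided by all `b ^ m • x` with `x ∈ Y` and `m ≠ 0`. -/
theorem freeGroup_lift_injective_of_orbit {G α : Type*} [Group G] [MulAction G α] (t b : G)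
    (Y P : Set α) (v : α) (hvY : v ∈ Y) (hvP : v ∈ P) (htv : t • v = v)
    (htP : ∀ x ∈ P, ∀ n : ℤ, t ^ n • x ∈ P)
    (ht : ∀ n : ℤ, t ^ n = 1 → n = 0)
    (hbP : ∀ x ∈ Y, ∀ m : ℤ, m ≠ 0 → b ^ m • x ∉ P)
    (hY : ∀ x ∈ Y, ∀ m n : ℤ, m ≠ 0 → n ≠ 0 → t ^ n • b ^ m • x ∈ Y) :
    Function.Injective (FreeGroup.lift ![t, b] : FreeGroup (Fin 2) →* G) := by
  set ρ : FreeGroup (Fin 2) →* G := FreeGroup.lift ![t, b] with hρ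
  set τ : FreeGroup (Fin 2) := FreeGroup.of 0 with hτ_def
  set β : FreeGroup (Fin 2) := FreeGroup.of 1 with hβ_def
  have hτ : ∀ n : ℤ, ρ (τ ^ n) = t ^ n := by intro n; simp [hρ, τ]
  have hβ : ∀ n : ℤ, ρ (β ^ n) = b ^ n := by intro n; simp [hρ, β]
  have htv' : ∀ n : ℤ, t ^ n • v = v := fun n =>
    (MulAction.stabilizer G v).zpow_mem (MulAction.mem_stabilizer_iff.2 htv) n
  have hgen : Subgroup.closure {τ, β} = ⊤ := by
    rw [← FreeGroup.closure_range_of (Fin 2)]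
    congr 1
    ext x
    simp [Fin.exists_fin_two, τ, β, eq_comm]
  have hmem : ∀ g, IsAlternating τ β g → ρ g • v ∈ Y := by
    intro g hg
    induction hg with
    | zpow n => rw [hτ, htv']; exact hvY
    | step n m h hn hm _ ih =>
      rw [map_mul, map_mul, hτ, hβ, mul_smul, mul_smul]
      exact hY _ ih m n hm hn
  rw [injective_iff_map_eq_one]
  intro g hg
  rcases isAlternating_or_of_closure_eq_top hgen g with h | ⟨m, hm, h, hh, rfl⟩
  · cases h with
    | zpow n => rw [hτ] at hg; simp [ht n hg]
    | step n m h hn hm hh =>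
      refine absurd ?_ (hbP _ (hmem h hh) m hm)
      have h1 : t ^ n • b ^ m • ρ h • v = v := by
        rw [← hτ, ← hβ, ← mul_smul, ← mul_smul, ← map_mul, ← map_mul, mul_assoc, hg,
          one_smul]
      rw [smul_eq_iff_eq_inv_smul, ← _root_.zpow_neg] at h1
      rw [h1]
      exact htP v hvP _
  · refine absurd ?_ (hbP _ (hmem h hh) m hm)
    rw [← hβ, ← mul_smul, ← map_mul, hg, one_smul]
    exact hvP

section Integral

variable {R : Type*} [CommRing R]

/-- Multiplication by the companion matrix of `(x + 1) ^ 4 * (x ^ 2 + 1)`. -/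
def bAct (x : Fin 6 → R) : Fin 6 → R :=
  ![-x 5, x 0 - 4 * x 5, x 1 - 7 * x 5, x 2 - 8 * x 5, x 3 - 7 * x 5, x 4 - 4 * x 5]

/-- The inverse of `bAct`. -/
def bInvAct (x : Fin 6 → R) : Fin 6 → R :=
  ![x 1 - 4 * x 0, x 2 - 7 * x 0, x 3 - 8 * x 0, x 4 - 7 * x 0, x 5 - 4 * x 0, -x 0]

/-- The transvection `x ↦ x + x 0 • v`, where `v = (0, 10, -8, 28, -8, 10)`. -/
def tAct (x : Fin 6 → R) : Fin 6 → R :=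
  ![x 0, x 1 + 10 * x 0, x 2 - 8 * x 0, x 3 + 28 * x 0, x 4 - 8 * x 0, x 5 + 10 * x 0]

/-- An involution conjugating both `bAct` and `tAct` to their inverses. -/
def uAct (x : Fin 6 → R) : Fin 6 → R :=
  ![-x 0, x 5 - 4 * x 0, x 4 - 7 * x 0, x 3 - 8 * x 0, x 2 - 7 * x 0, x 1 - 4 * x 0]

/-- The nilpotent part `b ^ 4 - 1` of the unipotent map `b ^ 4`, applied to `x`. -/
def nilAct (b : (Fin 6 → R) → (Fin 6 → R)) (x : Fin 6 → R) : Fin 6 → R :=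
  b (b (b (b x))) - x

end Integral

/-- The extremal rays of the ping-pong cone. -/
def ray : Fin 8 → Fin 6 → ℤ :=
  ![![0, 1, -4, 6, -4, 1],
    ![0, 3, -8, 10, -8, 3],
    ![1, 5, 2, 18, -3, 9],
    ![1, 13, 3, 20, 4, 5],
    ![2, 12, 15, 20, 18, 10],
    ![3, 17, 2, 54, -5, 25],
    ![0, 271, 400, 381, 400, 271],
    ![43, 315, 6, 774, -49, 287]]

/-- Simplicial subcones of the ping-pong cone: three rows of indices, a common denominator, and the
functionals dual to the chosen rays, multiplied by the denominator. -/
def simplices : List ((Fin 6 → Fin 8) × ℕ × (Fin 6 → Fin 6 → ℤ)) :=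
  [(![0, 1, 2, 3, 4, 6], 661632, ![![-814674, -356037, 22278, 323328, 128154, -320571],
    ![221222, 130759, -176546, -142464, 57026, 245945],
    ![151624, -6892, 96488, 0, -96488, 6892],
    ![13784, 89596, 68920, 0, -68920, -89596],
    ![248112, -41352, -82704, 0, 82704, 41352],
    ![-13888, -32, 448, 384, 320, 800]]),
   (![0, 1, 2, 3, 4, 5], 544, ![![-2520, -297, 78, 317, 148, -157],
    ![-3512, 99, -26, -15, 132, 415],
    ![-6096, -20, 280, 172, 64, 364],
    ![1024, 76, 24, -28, -80, -132],
    ![-2400, -40, 16, 72, 128, 184],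
    ![3472, 8, -112, -96, -80, -200]]),
   (![0, 1, 2, 5, 6, 7], 413520, ![![-630270, -211440, 47010, 202080, 47010, -211440],
    ![-82710, 117720, -37350, -89040, -37350, 117720],
    ![-273957, 58582, 184361, 0, -184361, -58582],
    ![155070, -68920, -86150, 0, 86150, 68920],
    ![-7440, 240, 240, 240, 240, 240],
    ![5169, 3446, 1723, 0, -1723, -3446]]),
   (![0, 1, 3, 4, 5, 7], 32288, ![![-55440, -17319, 306, 16159, 7796, -14939],
    ![4016, 6573, -11302, -6885, 5604, 11945],
    ![-79072, 4052, 7848, 2284, -3280, 516],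
    ![8160, -1880, -5968, 24, 6016, 1928],
    ![-55696, -384, 5376, 1688, -2000, 3760],
    ![6096, 20, -280, -172, -64, -364]])]

/-- The value at `y` of the functional with coefficients `a`. -/
def dot6 (a y : Fin 6 → ℤ) : ℤ :=
  a 0 * y 0 + a 1 * y 1 + a 2 * y 2 + a 3 * y 3 + a 4 * y 4 + a 5 * y 5

/-- `y` is a nonzero element of one of the simplicial cones in `simplices`. -/
def InSimplex (y : Fin 6 → ℤ) : Prop :=
  ∃ s ∈ simplices, (∀ k, 0 ≤ dot6 (s.2.2 k) y) ∧ ∃ k, 0 < dot6 (s.2.2 k) y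

instance (y : Fin 6 → ℤ) : Decidable (InSimplex y) := by unfold InSimplex; infer_instance

theorem simplices_dual : ∀ s ∈ simplices, 0 < s.2.1 ∧
    ∀ i j, ∑ k, ray (s.1 k) i * s.2.2 k j = if i = j then (s.2.1 : ℤ) else 0 := by
  decide +kernel

/-- `z` is mapped into the ping-pong cone by `tAct`, and so are its images under powers of
`b ^ 4 - 1`. -/
def Absorbed (b : (Fin 6 → ℤ) → (Fin 6 → ℤ)) (z : Fin 6 → ℤ) : Prop :=
  (0 < z 0 ∧ InSimplex (tAct z)) ∧
  (0 ≤ nilAct b z 0 ∧ InSimplex (tAct (nilAct b z))) ∧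
  (0 ≤ nilAct b (nilAct b z) 0 ∧ InSimplex (tAct (nilAct b (nilAct b z)))) ∧
  (0 ≤ nilAct b (nilAct b (nilAct b z)) 0 ∧ InSimplex (tAct (nilAct b (nilAct b (nilAct b z)))))

instance (b : (Fin 6 → ℤ) → (Fin 6 → ℤ)) (z : Fin 6 → ℤ) : Decidable (Absorbed b z) := by
  unfold Absorbed; infer_instance

theorem absorbed_ray : ∀ i : Fin 8, ∀ s : Fin 4,
    Absorbed (-bAct ·) ((-bAct ·)^[s + 1] (ray i)) ∧
    Absorbed (-bAct ·) ((-bAct ·)^[s + 1] (uAct (ray i))) ∧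
    Absorbed (-bInvAct ·) ((-bInvAct ·)^[s + 1] (-ray i)) ∧
    Absorbed (-bInvAct ·) ((-bInvAct ·)^[s + 1] (-uAct (ray i))) := by
  decide +kernel

theorem inSimplex_transvection : InSimplex ![0, 10, -8, 28, -8, 10] := by
  decide +kernel

/-- The rational vector with the given integral coordinates. -/
def toRat (x : Fin 6 → ℤ) : Fin 6 → ℚ := fun i => x i

theorem toRat_bAct (x : Fin 6 → ℤ) : toRat (bAct x) = bAct (toRat x) := by
  ext i; fin_cases i <;> simp [toRat, bAct]

theorem toRat_bInvAct (x : Fin 6 → ℤ) : toRat (bInvAct x) = bInvAct (toRat x) := by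
  ext i; fin_cases i <;> simp [toRat, bInvAct]

theorem toRat_uAct (x : Fin 6 → ℤ) : toRat (uAct x) = uAct (toRat x) := by
  ext i; fin_cases i <;> simp [toRat, uAct]

theorem toRat_tAct (x : Fin 6 → ℤ) : toRat (tAct x) = tAct (toRat x) := by
  ext i; fin_cases i <;> simp [toRat, tAct]

theorem toRat_neg (x : Fin 6 → ℤ) : toRat (-x) = -toRat x := by
  ext i; simp [toRat]

theorem toRat_sub (x y : Fin 6 → ℤ) : toRat (x - y) = toRat x - toRat y := by
  ext i; simp [toRat]

/-- The ping-pong cone. -/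
def pingPongCone : ConvexCone ℚ (Fin 6 → ℚ) :=
  ConvexCone.hull ℚ (Set.range fun i => toRat (ray i))

theorem ConvexCone.sum_smul_mem {E ι : Type*} [AddCommGroup E] [Module ℚ E] (C : ConvexCone ℚ E)
    (s : Finset ι) (c : ι → ℚ) (x : ι → E) (hx : ∀ i ∈ s, x i ∈ C) (hc : ∀ i ∈ s, 0 ≤ c i)
    (hpos : ∃ i ∈ s, 0 < c i) : ∑ i ∈ s, c i • x i ∈ C := by
  classical
  induction s using Finset.induction_on with
  | empty => simp at hpos
  | insert a s ha ih =>
    rw [Finset.sum_insert ha]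
    have hxs : ∀ i ∈ s, x i ∈ C := fun i hi => hx i (Finset.mem_insert_of_mem hi)
    have hcs : ∀ i ∈ s, 0 ≤ c i := fun i hi => hc i (Finset.mem_insert_of_mem hi)
    have hxa : x a ∈ C := hx a (Finset.mem_insert_self a s)
    by_cases h : ∃ i ∈ s, 0 < c i
    · rcases (hc a (Finset.mem_insert_self a s)).eq_or_lt with h0 | h0
      · simpa [← h0] using ih hxs hcs h
      · exact C.add_mem (C.smul_mem h0 hxa) (ih hxs hcs h)
    · push Not at h
      rw [Finset.sum_eq_zero fun i hi => by rw [le_antisymm (h i hi) (hcs i hi), zero_smul],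
        add_zero]
      obtain ⟨i, hi, hi0⟩ := hpos
      rcases Finset.mem_insert.1 hi with rfl | hi
      · exact C.smul_mem hi0 hxa
      · exact absurd hi0 (h i hi).not_gt

theorem InSimplex.mem_pingPongCone {y : Fin 6 → ℤ} (hy : InSimplex y) :
    toRat y ∈ pingPongCone := by
  obtain ⟨⟨σ, D, φ⟩, hs, hnonneg, hpos⟩ := hy
  obtain ⟨hD, hdual⟩ := simplices_dual _ hs
  dsimp only at hnonneg hpos hD hdual
  have hD' : (0 : ℚ) < D := by exact_mod_cast hD
  have hsum : toRat y = ∑ k, ((dot6 (φ k) y : ℚ) / D) • toRat (ray (σ k)) := by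
    ext i
    have h : (D : ℤ) * y i = ∑ k, dot6 (φ k) y * ray (σ k) i := by
      have h1 : ∀ k, dot6 (φ k) y = ∑ j, φ k j * y j := fun k => by
        simp [dot6, Fin.sum_univ_six]
      simp only [h1, Finset.sum_mul]
      rw [Finset.sum_comm]
      have h2 : ∀ j, ∑ k, φ k j * y j * ray (σ k) i = (if i = j then (D : ℤ) else 0) * y j := by
        intro j
        rw [← hdual i j, Finset.sum_mul]
        exact Finset.sum_congr rfl fun k _ => by ring
      simp [h2]
    have h' : (D : ℚ) * y i = ∑ k, (dot6 (φ k) y : ℚ) * ray (σ k) i := by exact_mod_cast h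
    simp only [toRat, Finset.sum_apply, Pi.smul_apply, smul_eq_mul]
    rw [eq_comm, ← mul_right_inj' hD'.ne', h', Finset.mul_sum]
    exact Finset.sum_congr rfl fun k _ => by field_simp
  rw [hsum]
  refine ConvexCone.sum_smul_mem _ _ _ _
    (fun k _ => ConvexCone.subset_hull ⟨σ k, rfl⟩)
    (fun k _ => div_nonneg (by exact_mod_cast hnonneg k) hD'.le) ?_
  obtain ⟨k, hk⟩ := hpos
  exact ⟨k, Finset.mem_univ k, div_pos (by exact_mod_cast hk) hD'⟩

/-- `bAct` as a linear automorphism. -/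
def bEquiv : (Fin 6 → ℚ) ≃ₗ[ℚ] (Fin 6 → ℚ) where
  toFun := bAct
  invFun := bInvAct
  map_add' x y := by ext i; fin_cases i <;> simp [bAct] <;> ring
  map_smul' c x := by ext i; fin_cases i <;> simp [bAct] <;> ring
  left_inv x := by ext i; fin_cases i <;> simp [bAct, bInvAct]
  right_inv x := by ext i; fin_cases i <;> simp [bAct, bInvAct]

/-- `tAct` as a linear automorphism. -/
def tEquiv : (Fin 6 → ℚ) ≃ₗ[ℚ] (Fin 6 → ℚ) where
  toFun := tAct
  invFun x :=
    ![x 0, x 1 - 10 * x 0, x 2 + 8 * x 0, x 3 - 28 * x 0, x 4 + 8 * x 0, x 5 - 10 * x 0]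
  map_add' x y := by ext i; fin_cases i <;> simp [tAct] <;> ring
  map_smul' c x := by ext i; fin_cases i <;> simp [tAct] <;> ring
  left_inv x := by ext i; fin_cases i <;> simp [tAct]
  right_inv x := by ext i; fin_cases i <;> simp [tAct]

/-- `uAct` as a linear automorphism. -/
def uEquiv : (Fin 6 → ℚ) ≃ₗ[ℚ] (Fin 6 → ℚ) where
  toFun := uAct
  invFun := uAct
  map_add' x y := by ext i; fin_cases i <;> simp [uAct] <;> ring
  map_smul' c x := by ext i; fin_cases i <;> simp [uAct] <;> ring
  left_inv x := by ext i; fin_cases i <;> simp [uAct]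
  right_inv x := by ext i; fin_cases i <;> simp [uAct]

/-- The vectors in the open half-space `0 < x 0` that `tEquiv` maps into the ping-pong cone. -/
def absorbedCone : ConvexCone ℚ (Fin 6 → ℚ) where
  carrier := {z | 0 < z 0 ∧ tEquiv z ∈ pingPongCone}
  smul_mem' c hc x hx := ⟨by simpa using mul_pos hc hx.1, by
    rw [map_smul]; exact pingPongCone.smul_mem hc hx.2⟩
  add_mem' x hx y hy := ⟨add_pos hx.1 hy.1, by
    rw [map_add]; exact pingPongCone.add_mem hx.2 hy.2⟩

theorem mem_absorbedCone {z : Fin 6 → ℚ} :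
    z ∈ absorbedCone ↔ 0 < z 0 ∧ tEquiv z ∈ pingPongCone := Iff.rfl

/-- The rational analogue of `Absorbed` for a linear map `N` in place of `b ^ 4 - 1`. -/
def AbsorbedUnder (N : Module.End ℚ (Fin 6 → ℚ)) (z : Fin 6 → ℚ) : Prop :=
  (0 < z 0 ∧ tEquiv z ∈ pingPongCone) ∧
  (0 ≤ N z 0 ∧ tEquiv (N z) ∈ pingPongCone) ∧
  (0 ≤ N (N z) 0 ∧ tEquiv (N (N z)) ∈ pingPongCone) ∧
  (0 ≤ N (N (N z)) 0 ∧ tEquiv (N (N (N z))) ∈ pingPongCone)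

theorem AbsorbedUnder.add_apply {N : Module.End ℚ (Fin 6 → ℚ)} (hN : N ^ 4 = 0) {z : Fin 6 → ℚ}
    (hz : AbsorbedUnder N z) : AbsorbedUnder N (z + N z) := by
  obtain ⟨⟨h0, k0⟩, ⟨h1, k1⟩, ⟨h2, k2⟩, h3, k3⟩ := hz
  have h4 : N (N (N (N z))) = 0 := by simpa [pow_succ] using LinearMap.congr_fun hN z
  simp only [AbsorbedUnder, map_add, h4, add_zero, Pi.add_apply, Pi.zero_apply]
  exact ⟨⟨by positivity, pingPongCone.add_mem k0 k1⟩, ⟨by positivity, pingPongCone.add_mem k1 k2⟩,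
    ⟨by positivity, pingPongCone.add_mem k2 k3⟩, h3, k3⟩

theorem AbsorbedUnder.pow_apply {c : Module.End ℚ (Fin 6 → ℚ)} (hc : (c ^ 4 - 1) ^ 4 = 0)
    {z : Fin 6 → ℚ} (hz : AbsorbedUnder (c ^ 4 - 1) z) (q : ℕ) :
    AbsorbedUnder (c ^ 4 - 1) ((c ^ (4 * q)) z) := by
  induction q with
  | zero => simpa using hz
  | succ q ih =>
    convert ih.add_apply hc using 1
    rw [Nat.mul_succ, add_comm, pow_add]
    simp

theorem pow_four_sub_one_toRat {b : (Fin 6 → ℤ) → (Fin 6 → ℤ)} {c : Module.End ℚ (Fin 6 → ℚ)}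
    (hcb : ∀ x, c (toRat x) = toRat (b x)) (x : Fin 6 → ℤ) :
    (c ^ 4 - 1 : Module.End ℚ (Fin 6 → ℚ)) (toRat x) = toRat (nilAct b x) := by
  simp [pow_succ, hcb, nilAct, toRat_sub]

theorem pow_four_sub_one_pow_four_eq_zero {b : (Fin 6 → ℤ) → (Fin 6 → ℤ)}
    {c : Module.End ℚ (Fin 6 → ℚ)} (hcb : ∀ x, c (toRat x) = toRat (b x))
    (hb : ∀ i, nilAct b (nilAct b (nilAct b (nilAct b (Pi.single i 1)))) = 0) :
    (c ^ 4 - 1) ^ 4 = 0 := by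
  refine (Pi.basisFun ℚ (Fin 6)).ext fun i => ?_
  have h : Pi.basisFun ℚ (Fin 6) i = toRat (Pi.single i 1) := by
    ext j
    simp [toRat, Pi.single_apply]
  rw [h, Module.End.pow_apply]
  simp only [Function.iterate_succ_apply, Function.iterate_zero_apply,
    pow_four_sub_one_toRat hcb, hb]
  ext j
  simp [toRat]

theorem Absorbed.absorbedUnder {b : (Fin 6 → ℤ) → (Fin 6 → ℤ)} {c : Module.End ℚ (Fin 6 → ℚ)}
    (hcb : ∀ x, c (toRat x) = toRat (b x)) {z : Fin 6 → ℤ} (hz : Absorbed b z) :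
    AbsorbedUnder (c ^ 4 - 1) (toRat z) := by
  have ht : ∀ x, tEquiv (toRat x) = toRat (tAct x) := fun x => (toRat_tAct x).symm
  have hpos : ∀ x, 0 < x 0 → 0 < toRat x 0 := fun x hx => by simpa [toRat] using hx
  have hnonneg : ∀ x, 0 ≤ x 0 → 0 ≤ toRat x 0 := fun x hx => by simpa [toRat] using hx
  obtain ⟨⟨h0, k0⟩, ⟨h1, k1⟩, ⟨h2, k2⟩, h3, k3⟩ := hz
  simp only [AbsorbedUnder, pow_four_sub_one_toRat hcb, ht]
  exact ⟨⟨hpos _ h0, k0.mem_pingPongCone⟩, ⟨hnonneg _ h1, k1.mem_pingPongCone⟩,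
    ⟨hnonneg _ h2, k2.mem_pingPongCone⟩, hnonneg _ h3, k3.mem_pingPongCone⟩

theorem pow_apply_mem_absorbedCone {b : (Fin 6 → ℤ) → (Fin 6 → ℤ)}
    {c : Module.End ℚ (Fin 6 → ℚ)} (hcb : ∀ x, c (toRat x) = toRat (b x))
    (hc : (c ^ 4 - 1) ^ 4 = 0) {y : Fin 6 → ℤ} (hy : ∀ s : Fin 4, Absorbed b (b^[s + 1] y))
    {n : ℕ} (hn : n ≠ 0) : (c ^ n) (toRat y) ∈ absorbedCone := by
  have hpow : ∀ k, (c ^ k) (toRat y) = toRat (b^[k] y) := fun k => by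
    induction k with
    | zero => rfl
    | succ k ih => rw [pow_succ', Module.End.mul_apply, ih, hcb, Function.iterate_succ_apply']
  obtain ⟨q, s, rfl⟩ : ∃ (q : ℕ) (s : Fin 4), n = 4 * q + (s + 1) :=
    ⟨(n - 1) / 4, ⟨(n - 1) % 4, Nat.mod_lt _ (by norm_num)⟩, by dsimp only; omega⟩
  rw [pow_add, Module.End.mul_apply, hpow]
  exact (((hy s).absorbedUnder hcb).pow_apply hc q).1

theorem neg_bEquiv_toRat (x : Fin 6 → ℤ) : (-bEquiv.toLinearMap) (toRat x) = toRat (-bAct x) := by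
  rw [toRat_neg, toRat_bAct]
  rfl

theorem neg_bEquiv_symm_toRat (x : Fin 6 → ℤ) :
    (-bEquiv.symm.toLinearMap) (toRat x) = toRat (-bInvAct x) := by
  rw [toRat_neg, toRat_bInvAct]
  rfl

theorem apply_mem_of_forall_ray {C : ConvexCone ℚ (Fin 6 → ℚ)} (f : Module.End ℚ (Fin 6 → ℚ))
    (hf : ∀ i, f (toRat (ray i)) ∈ C) {x : Fin 6 → ℚ} (hx : x ∈ pingPongCone) : f x ∈ C := by
  have h : pingPongCone ≤ C.comap f := ConvexCone.hull_min (by rintro _ ⟨i, rfl⟩; exact hf i)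
  exact h hx

theorem neg_bEquiv_pow_mem {x : Fin 6 → ℚ} (hx : x ∈ pingPongCone) {n : ℕ} (hn : n ≠ 0) :
    ((-bEquiv.toLinearMap) ^ n : Module.End ℚ (Fin 6 → ℚ)) x ∈ absorbedCone ∧
    ((-bEquiv.toLinearMap) ^ n : Module.End ℚ (Fin 6 → ℚ)) (uEquiv x) ∈ absorbedCone := by
  have hc := pow_four_sub_one_pow_four_eq_zero neg_bEquiv_toRat (by decide +kernel)
  refine ⟨apply_mem_of_forall_ray _ (fun i => ?_) hx,
    apply_mem_of_forall_ray (_ * uEquiv.toLinearMap) (fun i => ?_) hx⟩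
  · exact pow_apply_mem_absorbedCone neg_bEquiv_toRat hc
      (fun s => (absorbed_ray i s).1) hn
  · have := pow_apply_mem_absorbedCone neg_bEquiv_toRat hc
      (fun s => (absorbed_ray i s).2.1) hn
    rwa [toRat_uAct] at this

theorem neg_bEquiv_symm_pow_mem {x : Fin 6 → ℚ} (hx : x ∈ pingPongCone) {n : ℕ} (hn : n ≠ 0) :
    -((-bEquiv.symm.toLinearMap) ^ n : Module.End ℚ (Fin 6 → ℚ)) x ∈ absorbedCone ∧
    -((-bEquiv.symm.toLinearMap) ^ n : Module.End ℚ (Fin 6 → ℚ)) (uEquiv x) ∈ absorbedCone := by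
  have hc := pow_four_sub_one_pow_four_eq_zero neg_bEquiv_symm_toRat (by decide +kernel)
  refine ⟨apply_mem_of_forall_ray (-_) (fun i => ?_) hx,
    apply_mem_of_forall_ray (-(_ * uEquiv.toLinearMap)) (fun i => ?_) hx⟩
  · have := pow_apply_mem_absorbedCone neg_bEquiv_symm_toRat hc
      (fun s => (absorbed_ray i s).2.2.1) hn
    rwa [toRat_neg, map_neg] at this
  · have := pow_apply_mem_absorbedCone neg_bEquiv_symm_toRat hc
      (fun s => (absorbed_ray i s).2.2.2) hn
    rwa [toRat_neg, map_neg, toRat_uAct] at this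

/-- Membership in a convex cone up to sign. -/
def MemUpToSign (C : ConvexCone ℚ (Fin 6 → ℚ)) (x : Fin 6 → ℚ) : Prop :=
  x ∈ C ∨ -x ∈ C

theorem memUpToSign_neg {C : ConvexCone ℚ (Fin 6 → ℚ)} {x : Fin 6 → ℚ} :
    MemUpToSign C (-x) ↔ MemUpToSign C x := by
  simp [MemUpToSign, or_comm]

theorem memUpToSign_neg_pow_apply {C : ConvexCone ℚ (Fin 6 → ℚ)}
    {f : Module.End ℚ (Fin 6 → ℚ)} {n : ℕ} {x : Fin 6 → ℚ} :
    MemUpToSign C (((-f) ^ n : Module.End ℚ (Fin 6 → ℚ)) x) ↔ MemUpToSign C ((f ^ n) x) := by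
  rw [neg_pow f]
  rcases neg_one_pow_eq_or (Module.End ℚ (Fin 6 → ℚ)) n with h | h
  · simp [h]
  · simp [h, memUpToSign_neg]

theorem LinearEquiv.coe_pow_apply {M : Type*} [AddCommGroup M] [Module ℚ M] (e : M ≃ₗ[ℚ] M)
    (n : ℕ) (x : M) : (e ^ n) x = ((e.toLinearMap : Module.End ℚ M) ^ n) x := by
  induction n with
  | zero => rfl
  | succ n ih => rw [pow_succ', pow_succ', LinearEquiv.mul_apply, ih]; rfl

theorem memUpToSign_bEquiv_zpow_of_mem {x : Fin 6 → ℚ} (hx : x ∈ pingPongCone) {m : ℤ}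
    (hm : m ≠ 0) :
    MemUpToSign absorbedCone ((bEquiv ^ m) x) ∧
    MemUpToSign absorbedCone ((bEquiv ^ m) (uEquiv x)) := by
  obtain ⟨n, rfl | rfl⟩ := m.eq_nat_or_neg
  · have hn : n ≠ 0 := by simpa using hm
    simp only [zpow_natCast, LinearEquiv.coe_pow_apply]
    rw [← memUpToSign_neg_pow_apply, ← memUpToSign_neg_pow_apply (x := uEquiv x)]
    exact ⟨Or.inl (neg_bEquiv_pow_mem hx hn).1, Or.inl (neg_bEquiv_pow_mem hx hn).2⟩
  · have hn : n ≠ 0 := by simpa using hm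
    have h : bEquiv⁻¹ = bEquiv.symm := rfl
    simp only [_root_.zpow_neg, zpow_natCast, ← inv_pow, h, LinearEquiv.coe_pow_apply]
    rw [← memUpToSign_neg_pow_apply, ← memUpToSign_neg_pow_apply (x := uEquiv x)]
    exact ⟨Or.inr (neg_bEquiv_symm_pow_mem hx hn).1, Or.inr (neg_bEquiv_symm_pow_mem hx hn).2⟩

/-- The ping-pong table: the vectors `x` such that `x` or `uEquiv x` lies in the ping-pong cone up
to sign. -/
def pingPongTable : Set (Fin 6 → ℚ) :=
  {x | MemUpToSign pingPongCone x ∨ MemUpToSign pingPongCone (uEquiv x)}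

theorem uEquiv_uEquiv (x : Fin 6 → ℚ) : uEquiv (uEquiv x) = x := uEquiv.left_inv x

theorem uEquiv_mem_pingPongTable {x : Fin 6 → ℚ} :
    uEquiv x ∈ pingPongTable ↔ x ∈ pingPongTable := by
  simp [pingPongTable, uEquiv_uEquiv, or_comm]

theorem memUpToSign_bEquiv_zpow {x : Fin 6 → ℚ} (hx : x ∈ pingPongTable) {m : ℤ} (hm : m ≠ 0) :
    MemUpToSign absorbedCone ((bEquiv ^ m) x) := by
  rcases hx with (hx | hx) | hx | hx
  · exact (memUpToSign_bEquiv_zpow_of_mem hx hm).1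
  · simpa [memUpToSign_neg] using (memUpToSign_bEquiv_zpow_of_mem hx hm).1
  · simpa [uEquiv_uEquiv] using (memUpToSign_bEquiv_zpow_of_mem hx hm).2
  · simpa [uEquiv_uEquiv, memUpToSign_neg] using (memUpToSign_bEquiv_zpow_of_mem hx hm).2

theorem MemUpToSign.apply_zero_ne_zero {x : Fin 6 → ℚ} (hx : MemUpToSign absorbedCone x) :
    x 0 ≠ 0 := by
  rcases hx with hx | hx
  · exact hx.1.ne'
  · simpa using (mem_absorbedCone.1 hx).1.ne'

/-- The direction of the transvection `tEquiv`. -/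
def transvectionVector : Fin 6 → ℚ := ![0, 10, -8, 28, -8, 10]

theorem transvectionVector_mem : transvectionVector ∈ pingPongCone := by
  convert inSimplex_transvection.mem_pingPongCone using 1
  ext i; fin_cases i <;> simp [toRat, transvectionVector]

theorem tEquiv_apply (x : Fin 6 → ℚ) : tEquiv x = x + x 0 • transvectionVector := by
  ext i; fin_cases i <;> simp [tEquiv, tAct, transvectionVector] <;> ring

theorem tEquiv_zpow_apply (n : ℤ) (x : Fin 6 → ℚ) :
    (tEquiv ^ n) x = x + (n * x 0) • transvectionVector := by
  have h0 : transvectionVector 0 = 0 := rfl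
  have hinv : ∀ x, tEquiv⁻¹ x = x - x 0 • transvectionVector := fun x => by
    change tEquiv.symm x = _
    rw [LinearEquiv.symm_apply_eq, tEquiv_apply]
    simp [h0]
  induction n generalizing x with
  | zero => simp
  | succ n ih =>
    rw [_root_.zpow_add_one, LinearEquiv.mul_apply, ih, tEquiv_apply]
    simp [h0, add_mul, add_smul, add_assoc, add_comm]
  | pred n ih =>
    rw [_root_.zpow_sub_one, LinearEquiv.mul_apply, ih, hinv]
    simp [h0, sub_mul, sub_smul]
    abel

theorem tEquiv_pow_succ_mem {z : Fin 6 → ℚ} (hz : z ∈ absorbedCone) (n : ℕ) :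
    (tEquiv ^ ((n : ℤ) + 1)) z ∈ pingPongCone := by
  have h : (tEquiv ^ ((n : ℤ) + 1)) z = tEquiv z + (n * z 0) • transvectionVector := by
    rw [tEquiv_zpow_apply, tEquiv_apply]
    push_cast
    rw [add_mul, add_smul, one_mul]
    abel
  rw [h]
  rcases n.eq_zero_or_pos with rfl | hn
  · simpa using hz.2
  · exact pingPongCone.add_mem hz.2 (pingPongCone.smul_mem
      (mul_pos (by exact_mod_cast hn) hz.1) transvectionVector_mem)

theorem tEquiv_zpow_mem_pingPongTable {z : Fin 6 → ℚ} (hz : MemUpToSign absorbedCone z) {n : ℤ}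
    (hn : 0 < n) : (tEquiv ^ n) z ∈ pingPongTable := by
  obtain ⟨k, rfl⟩ : ∃ k : ℕ, n = k + 1 := ⟨(n - 1).toNat, by omega⟩
  refine Or.inl (hz.imp (fun h => tEquiv_pow_succ_mem h k) fun h => ?_)
  rw [← map_neg]
  exact tEquiv_pow_succ_mem h k

theorem semiconjBy_uEquiv_bEquiv : SemiconjBy uEquiv bEquiv bEquiv⁻¹ := by
  apply LinearEquiv.ext
  intro x
  change uAct (bAct x) = bInvAct (uAct x)
  ext i; fin_cases i <;> simp [uAct, bAct, bInvAct]

theorem semiconjBy_uEquiv_tEquiv : SemiconjBy uEquiv tEquiv tEquiv⁻¹ := by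
  rw [SemiconjBy, eq_inv_mul_iff_mul_eq]
  apply LinearEquiv.ext
  intro x
  change tAct (uAct (tAct x)) = uAct x
  ext i; fin_cases i <;> simp [uAct, tAct] <;> ring

theorem tEquiv_zpow_bEquiv_zpow_mem {x : Fin 6 → ℚ} (hx : x ∈ pingPongTable) {m n : ℤ}
    (hm : m ≠ 0) (hn : n ≠ 0) : (tEquiv ^ n) ((bEquiv ^ m) x) ∈ pingPongTable := by
  rcases hn.lt_or_gt with h | h
  · rw [← uEquiv_mem_pingPongTable]
    have hu : uEquiv ((tEquiv ^ n) ((bEquiv ^ m) x)) =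
        (tEquiv ^ (-n)) ((bEquiv ^ (-m)) (uEquiv x)) := by
      have hs := (semiconjBy_uEquiv_tEquiv.zpow_right n).mul_right
        (semiconjBy_uEquiv_bEquiv.zpow_right m)
      rw [_root_.inv_zpow', _root_.inv_zpow'] at hs
      exact LinearEquiv.congr_fun hs x
    rw [hu]
    exact tEquiv_zpow_mem_pingPongTable (memUpToSign_bEquiv_zpow
      (uEquiv_mem_pingPongTable.2 hx) (neg_ne_zero.2 hm)) (neg_pos.2 h)
  · exact tEquiv_zpow_mem_pingPongTable (memUpToSign_bEquiv_zpow hx hm) h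

theorem freeGroup_lift_tEquiv_bEquiv_injective :
    Function.Injective
      (FreeGroup.lift ![tEquiv, bEquiv] : FreeGroup (Fin 2) →* ((Fin 6 → ℚ) ≃ₗ[ℚ] (Fin 6 → ℚ))) := by
  have hv : transvectionVector 0 = 0 := rfl
  refine freeGroup_lift_injective_of_orbit _ _ pingPongTable {x | x 0 = 0} transvectionVector
    (Or.inl (Or.inl transvectionVector_mem)) hv ?_ ?_ ?_ ?_ ?_
  · rw [LinearEquiv.smul_def, tEquiv_apply, hv, zero_smul, add_zero]
  · intro x hx n
    rw [Set.mem_ofPred_eq] at hx ⊢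
    rw [LinearEquiv.smul_def, tEquiv_zpow_apply]
    simp [hx, transvectionVector]
  · intro n hn
    have h := congr_fun (LinearEquiv.congr_fun hn (Pi.single 0 1)) 1
    rw [tEquiv_zpow_apply] at h
    simpa [transvectionVector] using h
  · intro x hx m hm
    exact (memUpToSign_bEquiv_zpow hx hm).apply_zero_ne_zero
  · intro x hx m n hm hn
    exact tEquiv_zpow_bEquiv_zpow_mem hx hm hn

theorem companionMatrix_mulVec_eq_bAct (x : Fin 6 → ℚ) :
    companionMatrix 6 ((X + 1) ^ 4 * (X ^ 2 + 1)) *ᵥ x = bAct x := by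
  have h : ((X + 1) ^ 4 * (X ^ 2 + 1) : ℚ[X]) =
      X ^ 6 + 4 * X ^ 5 + 7 * X ^ 4 + 8 * X ^ 3 + 7 * X ^ 2 + 4 * X + 1 := by ring
  rw [h]
  ext i
  fin_cases i <;>
    simp [companionMatrix, bAct, mulVec, dotProduct, Fin.sum_univ_six, coeff_X, coeff_one,
      coeff_X_pow] <;> ring

theorem bAct_eq_tAct_companionMatrix_mulVec (x : Fin 6 → ℚ) :
    bAct x = tAct (companionMatrix 6 ((X - 1) ^ 6) *ᵥ x) := by
  have h : ((X - 1) ^ 6 : ℚ[X]) =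
      X ^ 6 - 6 * X ^ 5 + 15 * X ^ 4 - 20 * X ^ 3 + 15 * X ^ 2 - 6 * X + 1 := by ring
  rw [h]
  ext i
  fin_cases i <;>
    simp [companionMatrix, bAct, tAct, mulVec, dotProduct, Fin.sum_univ_six, coeff_X, coeff_one,
      coeff_X_pow] <;> ring

/-- The hypergeometric group of case A3 is free of rank 2 on `T = B * A⁻¹` and `B`. -/
theorem thm_A3 (A B : GL (Fin 6) ℚ)
    (hA : (A : Matrix (Fin 6) (Fin 6) ℚ) = companionMatrix 6 ((X - 1) ^ 6))
    (hB : (B : Matrix (Fin 6) (Fin 6) ℚ) = companionMatrix 6 ((X + 1) ^ 4 * (X ^ 2 + 1))) :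
    Function.Injective (FreeGroup.lift ![B * A⁻¹, B] : FreeGroup (Fin 2) →* GL (Fin 6) ℚ) := by
  let ψ : GL (Fin 6) ℚ →* ((Fin 6 → ℚ) ≃ₗ[ℚ] (Fin 6 → ℚ)) :=
    (LinearMap.GeneralLinearGroup.generalLinearEquiv ℚ (Fin 6 → ℚ)).toMonoidHom.comp
      (Matrix.GeneralLinearGroup.toLin (n := Fin 6) (R := ℚ)).toMonoidHom
  have hψ : ∀ g x, ψ g x = (g : Matrix (Fin 6) (Fin 6) ℚ) *ᵥ x := fun g x => rfl
  have hψB : ψ B = bEquiv := by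
    apply LinearEquiv.ext
    intro x
    rw [hψ, hB, companionMatrix_mulVec_eq_bAct]
    rfl
  have hψT : ψ (B * A⁻¹) = tEquiv := by
    rw [map_mul, map_inv, mul_inv_eq_iff_eq_mul, hψB]
    apply LinearEquiv.ext
    intro x
    rw [LinearEquiv.mul_apply, hψ, hA]
    exact bAct_eq_tAct_companionMatrix_mulVec x
  have hcomp : ψ.comp (FreeGroup.lift ![B * A⁻¹, B]) = FreeGroup.lift ![tEquiv, bEquiv] := by
    ext i : 1
    fin_cases i
    · simpa using hψT
    · simpa using hψB
  refine Function.Injective.of_comp (f := ψ) ?_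
  rw [← MonoidHom.coe_comp, hcomp]
  exact freeGroup_lift_tEquiv_bEquiv_injective
end
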